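/- arXiv:1507.05046 — 8 statements merged into one kernel-verified Lean document; each statement's English description precedes it below -/
import Mathlib

section
/- Let n ≥ 3, let X and Y be real n-normed spaces with n-norms N_X and N_Y, and let φ : X → Y be a (not necessarily surjective) map satisfying N_Y(φ(x₁),…,φ(xₙ)) = N_X(x₁,…,xₙ) for all x₁,…,xₙ ∈ X (an n-norm preserver). Then φ is plus-minus linear: there exists a linear map A : X → Y such that for every x ∈ X, either φ(x) = A x or φ(x) = −A x. -/
/-- An `n`-norm on a real vector space `X`: a nonnegative `n`-variable function that
vanishes exactly on linearly dependent tuples, is symmetric under permutations,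
is absolutely homogeneous in each variable, and is subadditive in each variable. -/
structure IsNNorm (n : ℕ) (X : Type*) [AddCommGroup X] [Module ℝ X]
    (N : (Fin n → X) → ℝ) : Prop where
  nonneg : ∀ v : Fin n → X, 0 ≤ N v
  eq_zero_iff : ∀ v : Fin n → X, N v = 0 ↔ ¬ LinearIndependent ℝ v
  perm : ∀ (v : Fin n → X) (σ : Equiv.Perm (Fin n)), N (v ∘ σ) = N v
  smul : ∀ (v : Fin n → X) (i : Fin n) (α : ℝ),
    N (Function.update v i (α • v i)) = |α| * N v
  add_le : ∀ (v : Fin n → X) (i : Fin n) (y : X),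
    N (Function.update v i (v i + y)) ≤ N v + N (Function.update v i y)

/-- Replacing one member of a finite independent family by a vector outside the span of the
other members keeps the family independent. -/
theorem LinearIndependent.update_of_notMem_span {n : ℕ} {V : Type*} [AddCommGroup V] [Module ℝ V]
    {v : Fin n → V} (hv : LinearIndependent ℝ v) {i : Fin n} {w : V}
    (hw : w ∉ Submodule.span ℝ (v '' {i}ᶜ)) :
    LinearIndependent ℝ (Function.update v i w) := by
  rw [Fintype.linearIndependent_iff] at hv ⊢
  intro g hg
  rw [← Finset.add_sum_erase _ _ (Finset.mem_univ i), Function.update_self] at hg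
  have hsum : ∑ j ∈ Finset.univ.erase i, g j • Function.update v i w j
      = ∑ j ∈ Finset.univ.erase i, g j • v j :=
    Finset.sum_congr rfl fun j hj => by
      rw [Function.update_of_ne (Finset.ne_of_mem_erase hj)]
  rw [hsum] at hg
  have hmem : ∑ j ∈ Finset.univ.erase i, g j • v j ∈ Submodule.span ℝ (v '' {i}ᶜ) :=
    Submodule.sum_mem _ fun j hj => Submodule.smul_mem _ _
      (Submodule.subset_span ⟨j, Finset.ne_of_mem_erase hj, rfl⟩)
  have hgi : g i = 0 := by
    by_contra hne
    refine hw ((Submodule.smul_mem_iff _ hne).1 ?_)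
    rw [eq_neg_of_add_eq_zero_left hg]
    exact Submodule.neg_mem _ hmem
  refine hv g ?_
  rw [← Finset.add_sum_erase _ _ (Finset.mem_univ i), hgi]
  simpa [hgi] using hg

theorem not_linearIndependent_update_of_mem_span {n : ℕ} {V : Type*} [AddCommGroup V] [Module ℝ V]
    {v : Fin n → V} {i : Fin n} {w : V} (hw : w ∈ Submodule.span ℝ (v '' {i}ᶜ)) :
    ¬ LinearIndependent ℝ (Function.update v i w) := by
  intro h
  have h' := h.notMem_span_image (s := {i}ᶜ) (x := i) (by simp)
  rw [Function.update_self] at h'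
  have himg : Function.update v i w '' {i}ᶜ = v '' {i}ᶜ :=
    Set.image_congr fun j hj => Function.update_of_ne hj _ _
  exact h' (himg ▸ hw)

/-- A vector lying in the span of all members but one, for every omitted member outside a proper
subset `S`, lies in the span of the members indexed by `S`. -/
theorem LinearIndependent.mem_span_image_of_forall_notMem {n : ℕ} {V : Type*} [AddCommGroup V]
    [Module ℝ V] {v : Fin n → V} (hv : LinearIndependent ℝ v) {S : Set (Fin n)} (hS : S ≠ Set.univ)
    {w : V} (hw : ∀ j ∉ S, w ∈ Submodule.span ℝ (v '' {j}ᶜ)) :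
    w ∈ Submodule.span ℝ (v '' S) := by
  obtain ⟨j₀, hj₀⟩ := (Set.ne_univ_iff_exists_notMem S).1 hS
  obtain ⟨l, -, hl⟩ := (Finsupp.mem_span_image_iff_linearCombination ℝ).1 (hw j₀ hj₀)
  refine (Finsupp.mem_span_image_iff_linearCombination ℝ).2 ⟨l, ?_, hl⟩
  rw [Finsupp.mem_supported']
  intro j hj
  obtain ⟨l', hl'S, hl'⟩ := (Finsupp.mem_span_image_iff_linearCombination ℝ).1 (hw j hj)
  rw [hv (hl.trans hl'.symm)]
  exact (Finsupp.mem_supported' ℝ l').1 hl'S j (by simp)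

theorem LinearIndependent.exists_comp_castLE {V : Type*} [AddCommGroup V] [Module ℝ V] {k n : ℕ}
    (hkn : k ≤ n) (hn : (n : Cardinal) ≤ Module.rank ℝ V) {v : Fin k → V}
    (hv : LinearIndependent ℝ v) :
    ∃ w : Fin n → V, LinearIndependent ℝ w ∧ ∀ i, w (Fin.castLE hkn i) = v i := by
  induction n, hkn using Nat.le_induction with
  | base => exact ⟨v, hv, fun i => rfl⟩
  | succ m hkm ih =>
    have hlt : (m : Cardinal) < Module.rank ℝ V :=
      lt_of_lt_of_le (by exact_mod_cast Nat.lt_succ_self m) hn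
    obtain ⟨w, hw, hwv⟩ := ih hlt.le
    obtain ⟨x, hx⟩ := exists_linearIndependent_snoc_of_lt_rank hw hlt
    refine ⟨_, hx, fun i => ?_⟩
    rw [← hwv i]
    exact Fin.snoc_castSucc (α := fun _ => V) x w (Fin.castLE hkm i)

namespace IsNNorm

variable {n : ℕ} {X : Type*} [AddCommGroup X] [Module ℝ X] {N : (Fin n → X) → ℝ}

theorem update_add_of_mem_span (hN : IsNNorm n X N) {v : Fin n → X} {i : Fin n} {z : X} (x : X)
    (hz : z ∈ Submodule.span ℝ (v '' {i}ᶜ)) :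
    N (Function.update v i (x + z)) = N (Function.update v i x) := by
  have hle : ∀ (x : X) {z : X}, z ∈ Submodule.span ℝ (v '' {i}ᶜ) →
      N (Function.update v i (x + z)) ≤ N (Function.update v i x) := fun x z hz => by
    have h := hN.add_le (Function.update v i x) i z
    rwa [Function.update_self, Function.update_idem, Function.update_idem,
      (hN.eq_zero_iff _).2 (not_linearIndependent_update_of_mem_span hz), add_zero] at h
  refine le_antisymm (hle x hz) ?_
  simpa using hle (x + z) (Submodule.neg_mem _ hz)

theorem update_smul_add (hN : IsNNorm n X N) {v : Fin n → X} {i : Fin n} {z : X} (a : ℝ)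
    (hz : z ∈ Submodule.span ℝ (v '' {i}ᶜ)) :
    N (Function.update v i (a • v i + z)) = |a| * N v := by
  rw [hN.update_add_of_mem_span _ hz, hN.smul]

variable {Y : Type*} [AddCommGroup Y] [Module ℝ Y] {M : (Fin n → Y) → ℝ} {φ : X → Y}

theorem linearIndependent_map_iff (hN : IsNNorm n X N) (hM : IsNNorm n Y M)
    (hφ : ∀ x : Fin n → X, M (fun i => φ (x i)) = N x) (v : Fin n → X) :
    LinearIndependent ℝ (φ ∘ v) ↔ LinearIndependent ℝ v := by
  rw [← not_iff_not, ← hN.eq_zero_iff, ← hM.eq_zero_iff, ← hφ v, Function.comp_def]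

theorem map_mem_span_image (hN : IsNNorm n X N) (hM : IsNNorm n Y M)
    (hφ : ∀ x : Fin n → X, M (fun i => φ (x i)) = N x) {v : Fin n → X}
    (hv : LinearIndependent ℝ v) {S : Set (Fin n)} (hS : S ≠ Set.univ) {w : X}
    (hw : w ∈ Submodule.span ℝ (v '' S)) :
    φ w ∈ Submodule.span ℝ ((φ ∘ v) '' S) := by
  have hφv := (linearIndependent_map_iff hN hM hφ v).2 hv
  refine hφv.mem_span_image_of_forall_notMem hS fun j hj => ?_
  by_contra hmem
  have h := hφv.update_of_notMem_span hmem
  rw [← Function.comp_update, linearIndependent_map_iff hN hM hφ] at h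
  refine not_linearIndependent_update_of_mem_span (Submodule.span_mono ?_ hw) h
  exact Set.image_mono fun i hi hij => hj (hij ▸ hi)

theorem abs_coeff_eq (hN : IsNNorm n X N) (hM : IsNNorm n Y M)
    (hφ : ∀ x : Fin n → X, M (fun i => φ (x i)) = N x) {v : Fin n → X}
    (hv : LinearIndependent ℝ v) {i : Fin n} {a b : ℝ} {z : X} {z' : Y}
    (hz : z ∈ Submodule.span ℝ (v '' {i}ᶜ)) (hz' : z' ∈ Submodule.span ℝ ((φ ∘ v) '' {i}ᶜ))
    (h : φ (a • v i + z) = b • φ (v i) + z') : |b| = |a| := by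
  have h1 := hφ (Function.update v i (a • v i + z))
  have h2 := hM.update_smul_add b hz'
  change M (φ ∘ Function.update v i (a • v i + z)) = _ at h1
  rw [Function.comp_update, hN.update_smul_add a hz, h] at h1
  rw [Function.comp_apply, h1] at h2
  have hne : N v ≠ 0 := fun h0 => (hN.eq_zero_iff v).1 h0 hv
  have hMN : M (φ ∘ v) = N v := hφ v
  rw [hMN] at h2
  exact (mul_right_cancel₀ hne h2).symm

theorem linearIndependent_map_of_le (hN : IsNNorm n X N) (hM : IsNNorm n Y M)
    (hφ : ∀ x : Fin n → X, M (fun i => φ (x i)) = N x) (hX : (n : Cardinal) ≤ Module.rank ℝ X)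
    {k : ℕ} (hkn : k ≤ n) {v : Fin k → X} (hv : LinearIndependent ℝ v) :
    LinearIndependent ℝ (φ ∘ v) := by
  obtain ⟨w, hw, hwv⟩ := hv.exists_comp_castLE hkn hX
  have h := ((linearIndependent_map_iff hN hM hφ w).2 hw).comp _ (Fin.castLE_injective hkn)
  convert h using 1
  ext i
  simp [hwv]

theorem map_zero (hN : IsNNorm n X N) (hM : IsNNorm n Y M)
    (hφ : ∀ x : Fin n → X, M (fun i => φ (x i)) = N x) (hX : (n : Cardinal) ≤ Module.rank ℝ X)
    (hn : 0 < n) : φ 0 = 0 := by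
  obtain ⟨w, hw, -⟩ := (linearIndependent_empty_type (R := ℝ) (v := (Fin.elim0 : Fin 0 → X))
    ).exists_comp_castLE (Nat.zero_le n) hX
  have hS : (∅ : Set (Fin n)) ≠ Set.univ := by
    have : Nonempty (Fin n) := ⟨⟨0, hn⟩⟩
    exact Set.empty_ne_univ
  simpa using map_mem_span_image hN hM hφ hw hS (Submodule.zero_mem _)

theorem map_smul_eq (hN : IsNNorm n X N) (hM : IsNNorm n Y M)
    (hφ : ∀ x : Fin n → X, M (fun i => φ (x i)) = N x) (hX : (n : Cardinal) ≤ Module.rank ℝ X)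
    (hn : 2 ≤ n) (c : ℝ) (x : X) : ∃ s : ℝ, (s = 1 ∨ s = -1) ∧ φ (c • x) = (s * c) • φ x := by
  by_cases hx : x = 0
  · subst hx
    exact ⟨1, Or.inl rfl, by simp [map_zero hN hM hφ hX (by omega)]⟩
  have hLI : LinearIndependent ℝ ![x] := by
    rw [linearIndependent_unique_iff]
    simpa using hx
  obtain ⟨w, hw, hwx⟩ := hLI.exists_comp_castLE (show 1 ≤ n by omega) hX
  set i : Fin n := Fin.castLE (show 1 ≤ n by omega) 0 with hi
  have hwi : w i = x := by simpa using hwx 0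
  have hS : ({i} : Set (Fin n)) ≠ Set.univ := by
    intro h
    have h1 : (⟨1, by omega⟩ : Fin n) ∈ ({i} : Set (Fin n)) := h ▸ Set.mem_univ _
    simp [hi, Fin.ext_iff] at h1
  have hmem := map_mem_span_image hN hM hφ hw hS (w := c • x)
    (Submodule.smul_mem _ _ (Submodule.subset_span ⟨i, rfl, hwi⟩))
  rw [Set.image_singleton, Submodule.mem_span_singleton] at hmem
  obtain ⟨b, hb⟩ := hmem
  rw [Function.comp_apply, hwi] at hb
  have habs := abs_coeff_eq hN hM hφ hw (i := i) (a := c) (b := b) (Submodule.zero_mem _)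
    (Submodule.zero_mem _) (by simp [hwi, hb])
  rcases abs_eq_abs.1 habs with h | h
  · exact ⟨1, Or.inl rfl, by rw [← hb, h, one_mul]⟩
  · exact ⟨-1, Or.inr rfl, by rw [← hb, h, neg_one_mul]⟩

theorem map_add_eq (hN : IsNNorm n X N) (hM : IsNNorm n Y M)
    (hφ : ∀ x : Fin n → X, M (fun i => φ (x i)) = N x) (hX : (n : Cardinal) ≤ Module.rank ℝ X)
    (hn : 3 ≤ n) {x y : X} (hxy : LinearIndependent ℝ ![x, y]) :
    ∃ s t : ℝ, (s = 1 ∨ s = -1) ∧ (t = 1 ∨ t = -1) ∧ φ (x + y) = s • φ x + t • φ y := by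
  obtain ⟨w, hw, hwx⟩ := hxy.exists_comp_castLE (show 2 ≤ n by omega) hX
  set i : Fin n := Fin.castLE (show 2 ≤ n by omega) 0 with hi
  set j : Fin n := Fin.castLE (show 2 ≤ n by omega) 1 with hj
  have hwi : w i = x := by simpa using hwx 0
  have hwj : w j = y := by simpa using hwx 1
  have hij : i ≠ j := by simp [hi, hj, Fin.ext_iff]
  have hS : ({i, j} : Set (Fin n)) ≠ Set.univ := by
    intro h
    have h1 : (⟨2, by omega⟩ : Fin n) ∈ ({i, j} : Set (Fin n)) := h ▸ Set.mem_univ _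
    simp [hi, hj, Fin.ext_iff] at h1
  have hmem := map_mem_span_image hN hM hφ hw hS (w := x + y)
    (Submodule.add_mem _ (Submodule.subset_span ⟨i, by simp, hwi⟩)
      (Submodule.subset_span ⟨j, by simp, hwj⟩))
  rw [Set.image_pair, Submodule.mem_span_pair] at hmem
  obtain ⟨s, t, hst⟩ := hmem
  simp only [Function.comp_apply, hwi, hwj] at hst
  have mem : ∀ {k l : Fin n}, k ≠ l → w k ∈ Submodule.span ℝ (w '' {l}ᶜ) := fun {k l} hkl =>
    Submodule.subset_span ⟨k, hkl, rfl⟩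
  have mem' : ∀ {k l : Fin n} (c : ℝ), k ≠ l →
      c • φ (w k) ∈ Submodule.span ℝ ((φ ∘ w) '' {l}ᶜ) := fun {k l} c hkl =>
    Submodule.smul_mem _ _ (Submodule.subset_span ⟨k, hkl, rfl⟩)
  have hs := abs_coeff_eq hN hM hφ hw (i := i) (a := 1) (b := s) (mem hij.symm)
    (mem' t hij.symm) (by rw [hwi, hwj, one_smul, hst])
  have ht := abs_coeff_eq hN hM hφ hw (i := j) (a := 1) (b := t) (mem hij)
    (mem' s hij) (by rw [hwi, hwj, one_smul, add_comm y, ← hst, add_comm])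
  exact ⟨s, t, abs_eq_abs.1 hs, abs_eq_abs.1 ht, hst.symm⟩

end IsNNorm

theorem linearIndependent_triple_iff {V : Type*} [AddCommGroup V] [Module ℝ V] {x y z : V} :
    LinearIndependent ℝ ![x, y, z] ↔
      ∀ a b c : ℝ, a • x + b • y + c • z = 0 → a = 0 ∧ b = 0 ∧ c = 0 := by
  rw [Fintype.linearIndependent_iff]
  constructor
  · intro h a b c habc
    have h' := h ![a, b, c] (by simpa [Fin.sum_univ_three] using habc)
    exact ⟨h' 0, h' 1, h' 2⟩
  · intro h g hg
    obtain ⟨h0, h1, h2⟩ := h (g 0) (g 1) (g 2) (by simpa [Fin.sum_univ_three] using hg)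
    intro i
    fin_cases i <;> assumption

/-- Two vectors are equal up to sign. -/
def SignEq {V : Type*} [AddCommGroup V] [Module ℝ V] (u v : V) : Prop :=
  ∃ s : ℝ, (s = 1 ∨ s = -1) ∧ u = s • v

namespace SignEq

variable {V : Type*} [AddCommGroup V] [Module ℝ V] {u v w : V}

theorem refl (u : V) : SignEq u u := ⟨1, Or.inl rfl, (one_smul _ _).symm⟩

theorem symm (h : SignEq u v) : SignEq v u := by
  obtain ⟨s, rfl | rfl, rfl⟩ := h
  · exact ⟨1, Or.inl rfl, by simp⟩
  · exact ⟨-1, Or.inr rfl, by simp⟩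

theorem trans (h : SignEq u v) (h' : SignEq v w) : SignEq u w := by
  obtain ⟨s, hs, rfl⟩ := h
  obtain ⟨t, ht, rfl⟩ := h'
  refine ⟨s * t, ?_, by rw [mul_smul]⟩
  rcases hs with rfl | rfl <;> rcases ht with rfl | rfl <;> simp

theorem const_smul (h : SignEq u v) (c : ℝ) : SignEq (c • u) (c • v) := by
  obtain ⟨s, hs, rfl⟩ := h
  exact ⟨s, hs, smul_comm _ _ _⟩

theorem eq_or_eq_neg (h : SignEq u v) : u = v ∨ u = -v := by
  obtain ⟨s, rfl | rfl, rfl⟩ := h <;> simp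

end SignEq

theorem LinearIndependent.of_signEq {V ι : Type*} [AddCommGroup V] [Module ℝ V] {v w : ι → V}
    (hv : LinearIndependent ℝ v) (h : ∀ i, SignEq (w i) (v i)) : LinearIndependent ℝ w := by
  choose s hs hw using h
  have hs0 : ∀ i, s i ≠ 0 := fun i => by rcases hs i with h | h <;> simp [h]
  convert hv.units_smul (fun i => Units.mk0 (s i) (hs0 i)) using 1
  ext i
  exact hw i

/-- A map which is homogeneous, and additive on independent pairs, up to signs on the individual
terms, and which preserves the independence of pairs and triples. -/
structure IsTermwiseSignLinear {X Y : Type*} [AddCommGroup X] [Module ℝ X] [AddCommGroup Y]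
    [Module ℝ Y] (φ : X → Y) : Prop where
  map_smul : ∀ (c : ℝ) (x : X), SignEq (φ (c • x)) (c • φ x)
  map_add : ∀ {x y : X}, LinearIndependent ℝ ![x, y] →
    ∃ s t : ℝ, (s = 1 ∨ s = -1) ∧ (t = 1 ∨ t = -1) ∧ φ (x + y) = s • φ x + t • φ y
  linearIndependent_pair : ∀ {x y : X}, LinearIndependent ℝ ![x, y] →
    LinearIndependent ℝ ![φ x, φ y]
  linearIndependent_triple : ∀ {x y z : X}, LinearIndependent ℝ ![x, y, z] →
    LinearIndependent ℝ ![φ x, φ y, φ z]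

namespace IsTermwiseSignLinear

variable {X Y : Type*} [AddCommGroup X] [Module ℝ X] [AddCommGroup Y] [Module ℝ Y] {φ : X → Y}

theorem map_add_of_signEq (h : IsTermwiseSignLinear φ) {x y : X} {u v : Y}
    (hxy : LinearIndependent ℝ ![x, y]) (hx : SignEq (φ x) u) (hy : SignEq (φ y) v) :
    ∃ s t : ℝ, (s = 1 ∨ s = -1) ∧ (t = 1 ∨ t = -1) ∧ φ (x + y) = s • u + t • v := by
  obtain ⟨s, t, hs, ht, hst⟩ := h.map_add hxy
  obtain ⟨s', hs', hs'u⟩ := hx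
  obtain ⟨t', ht', ht'v⟩ := hy
  refine ⟨s * s', t * t', ?_, ?_, by rw [hst, hs'u, ht'v, mul_smul, mul_smul]⟩
  · rcases hs with rfl | rfl <;> rcases hs' with rfl | rfl <;> simp
  · rcases ht with rfl | rfl <;> rcases ht' with rfl | rfl <;> simp

theorem signEq_smul (h : IsTermwiseSignLinear φ) {x : X} {u : Y} (hx : SignEq (φ x) u) (c : ℝ) :
    SignEq (φ (c • x)) (c • u) :=
  (h.map_smul c x).trans (hx.const_smul c)

theorem signEq_add_smul (h : IsTermwiseSignLinear φ) {x y : X} {u v : Y}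
    (hxy : LinearIndependent ℝ ![x, y]) (hx : SignEq (φ x) u) (hy : SignEq (φ y) v)
    (hadd : SignEq (φ (x + y)) (u + v)) (t : ℝ) :
    SignEq (φ (x + t • y)) (u + t • v) := by
  have huv : LinearIndependent ℝ ![u, v] := (h.linearIndependent_pair hxy).of_signEq fun i => by
    fin_cases i
    exacts [hx.symm, hy.symm]
  rw [LinearIndependent.pair_iff] at huv
  rcases eq_or_ne t 0 with rfl | ht0
  · simpa using hx
  rcases eq_or_ne t 1 with rfl | ht1
  · simpa using hadd
  have hLI : LinearIndependent ℝ ![x, t • y] := by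
    rw [LinearIndependent.pair_iff] at hxy ⊢
    intro a b hab
    rw [smul_smul] at hab
    obtain ⟨ha, hb⟩ := hxy _ _ hab
    exact ⟨ha, (mul_eq_zero.1 hb).resolve_right ht0⟩
  have hLI' : LinearIndependent ℝ ![x + y, (t - 1) • y] := by
    rw [LinearIndependent.pair_iff] at hxy ⊢
    intro a b hab
    obtain ⟨ha, hb⟩ := hxy a (a + b * (t - 1)) (by rw [← hab]; module)
    rw [ha, zero_add] at hb
    exact ⟨ha, (mul_eq_zero.1 hb).resolve_right (sub_ne_zero.2 ht1)⟩
  obtain ⟨a, b, ha, hb, h1⟩ := h.map_add_of_signEq hLI hx (h.signEq_smul hy t)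
  obtain ⟨c, d, hc, hd, h2⟩ := h.map_add_of_signEq hLI' hadd (h.signEq_smul hy (t - 1))
  rw [show x + y + (t - 1) • y = x + t • y by module, h1] at h2
  obtain ⟨hac, hbt⟩ := huv (a - c) (b * t - c - d * (t - 1)) (by
    rw [← sub_eq_zero] at h2
    rw [← h2]
    module)
  obtain rfl : a = c := sub_eq_zero.1 hac
  have hab : a = b := by
    rcases ha with rfl | rfl <;> rcases hb with rfl | rfl <;> rcases hd with rfl | rfl <;>
      first | rfl | exact absurd (by linarith) ht0
  subst hab
  exact ⟨a, ha, by rw [h1, smul_add]⟩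

theorem signEq_smul_add_smul (h : IsTermwiseSignLinear φ) {x y : X} {u v : Y}
    (hxy : LinearIndependent ℝ ![x, y]) (hx : SignEq (φ x) u) (hy : SignEq (φ y) v)
    (hadd : SignEq (φ (x + y)) (u + v)) (s t : ℝ) :
    SignEq (φ (s • x + t • y)) (s • u + t • v) := by
  rcases eq_or_ne s 0 with rfl | hs
  · simpa using h.signEq_smul hy t
  have h' := h.signEq_smul (h.signEq_add_smul hxy hx hy hadd (t / s)) s
  rwa [smul_add, smul_add, smul_smul, smul_smul, mul_div_cancel₀ t hs] at h'

/-- Signs that agree relative to a common third vector agree with each other. -/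
theorem signEq_add_of_triple (h : IsTermwiseSignLinear φ) {e x y : X} {u v w : Y}
    (hexy : LinearIndependent ℝ ![e, x, y]) (he : SignEq (φ e) u) (hx : SignEq (φ x) v)
    (hy : SignEq (φ y) w) (hex : SignEq (φ (e + x)) (u + v)) (hey : SignEq (φ (e + y)) (u + w)) :
    SignEq (φ (x + y)) (v + w) := by
  have huvw : LinearIndependent ℝ ![u, v, w] :=
    (h.linearIndependent_triple hexy).of_signEq fun i => by
      fin_cases i
      exacts [he.symm, hx.symm, hy.symm]
  rw [linearIndependent_triple_iff] at huvw hexy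
  have hLI : LinearIndependent ℝ ![x, y] := LinearIndependent.pair_iff.2 fun a b hab =>
    (hexy 0 a b (by rw [← hab]; module)).2
  have hLI₁ : LinearIndependent ℝ ![e + x, y] := LinearIndependent.pair_iff.2 fun a b hab =>
    (hexy a a b (by rw [← hab]; module)).2
  have hLI₂ : LinearIndependent ℝ ![e + y, x] := LinearIndependent.pair_iff.2 fun a b hab =>
    (hexy a b a (by rw [← hab]; module)).imp_right And.left
  have hLI₃ : LinearIndependent ℝ ![e, x + y] := LinearIndependent.pair_iff.2 fun a b hab =>
    (hexy a b b (by rw [← hab]; module)).imp_right And.left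
  obtain ⟨a, b, ha, hb, hxy⟩ := h.map_add_of_signEq hLI hx hy
  obtain ⟨a₁, b₁, -, -, h₁⟩ := h.map_add_of_signEq hLI₁ hex hy
  obtain ⟨a₂, b₂, ha₂, -, h₂⟩ := h.map_add_of_signEq hLI₂ hey hx
  obtain ⟨a₃, b₃, -, hb₃, h₃⟩ := h.map_add_of_signEq hLI₃ he (SignEq.refl (φ (x + y)))
  rw [hxy, show e + (x + y) = e + x + y by abel, h₁] at h₃
  rw [show e + y + x = e + x + y by abel, h₁] at h₂
  obtain ⟨e₁, e₂, e₃⟩ := huvw (a₁ - a₂) (a₁ - b₂) (b₁ - a₂) (by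
    rw [← sub_eq_zero] at h₂
    rw [← h₂]
    module)
  obtain ⟨e₄, e₅, e₆⟩ := huvw (a₁ - a₃) (a₁ - b₃ * a) (b₁ - b₃ * b) (by
    rw [← sub_eq_zero] at h₃
    rw [← h₃]
    module)
  have hb₃0 : b₃ ≠ 0 := by rcases hb₃ with rfl | rfl <;> simp
  obtain rfl : a = b := mul_left_cancel₀ hb₃0 (by linarith)
  exact ⟨a, ha, by rw [hxy, smul_add]⟩

theorem exists_linearMap [Nontrivial X] (h : IsTermwiseSignLinear φ) :
    ∃ A : X →ₗ[ℝ] Y, ∀ x, SignEq (φ x) (A x) := by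
  let b := Module.Basis.ofVectorSpace ℝ X
  obtain ⟨i₀⟩ := b.index_nonempty
  have hpair : ∀ {i}, i ≠ i₀ → LinearIndependent ℝ ![b i₀, b i] := fun {i} hi => by
    rw [LinearIndependent.pair_iff' (b.ne_zero i₀)]
    intro a ha
    refine b.linearIndependent.notMem_span_image (s := {i₀}) (x := i) (by simpa using hi) ?_
    rw [Set.image_singleton, Submodule.mem_span_singleton]
    exact ⟨a, ha⟩
  have hf : ∀ i, ∃ y, SignEq (φ (b i)) y ∧ (i = i₀ → y = φ (b i₀)) ∧
      (i ≠ i₀ → SignEq (φ (b i₀ + b i)) (φ (b i₀) + y)) := fun i => by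
    rcases eq_or_ne i i₀ with rfl | hi
    · exact ⟨_, SignEq.refl _, fun _ => rfl, fun hi => absurd rfl hi⟩
    obtain ⟨s, t, hs, ht, hst⟩ := h.map_add (hpair hi)
    have hss : s * s = 1 := by rcases hs with rfl | rfl <;> norm_num
    refine ⟨(s * t) • φ (b i), SignEq.symm ⟨s * t, ?_, rfl⟩, fun hi' => absurd hi' hi,
      fun _ => ⟨s, hs, ?_⟩⟩
    · rcases hs with rfl | rfl <;> rcases ht with rfl | rfl <;> simp
    · rw [hst, smul_add, smul_smul, ← mul_assoc, hss, one_mul]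
  choose f hf hf₀ hf₁ using hf
  let A : X →ₗ[ℝ] Y := b.constr ℝ f
  have hA : ∀ i, A (b i) = f i := fun i => b.constr_basis ℝ f i
  have hline : ∀ i (t c : ℝ), SignEq (φ (t • b i₀ + c • b i)) (A (t • b i₀ + c • b i)) := by
    intro i t c
    rcases eq_or_ne i i₀ with rfl | hi
    · rw [← add_smul, _root_.map_smul, hA]
      exact h.signEq_smul (hf i) _
    · rw [_root_.map_add, _root_.map_smul, _root_.map_smul, hA, hA]
      refine h.signEq_smul_add_smul (hpair hi) (hf i₀) (hf i) ?_ t c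
      rw [hf₀ i₀ rfl]
      exact hf₁ i hi
  have key : ∀ (g : _ →₀ ℝ) (t : ℝ), SignEq (φ (t • b i₀ + Finsupp.linearCombination ℝ b g))
      (A (t • b i₀ + Finsupp.linearCombination ℝ b g)) := by
    intro g
    induction g using Finsupp.induction with
    | zero => intro t; simpa using hline i₀ t 0
    | single_add i c g hig hc ih =>
      intro t
      rw [_root_.map_add, Finsupp.linearCombination_single]
      rcases eq_or_ne i i₀ with rfl | hi
      · rw [← add_assoc, ← add_smul]
        exact ih _
      set x := t • b i₀ + Finsupp.linearCombination ℝ b g with hx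
      rw [show t • b i₀ + (c • b i + Finsupp.linearCombination ℝ b g) = x + c • b i by
        rw [hx]; abel]
      by_cases hspan : ∃ a : ℝ, a • b i₀ = x
      · obtain ⟨a, ha⟩ := hspan
        rw [← ha]
        exact hline i a c
      have hLI : LinearIndependent ℝ ![b i₀, x] :=
        (LinearIndependent.pair_iff' (b.ne_zero i₀)).2 (not_exists.1 hspan)
      have hi₀mem : b i₀ ∈ Submodule.span ℝ (b '' {i}ᶜ) :=
        Submodule.subset_span ⟨i₀, hi.symm, rfl⟩
      have hxmem : x ∈ Submodule.span ℝ (b '' {i}ᶜ) := by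
        refine Submodule.add_mem _ (Submodule.smul_mem _ _ hi₀mem) ?_
        refine (Finsupp.mem_span_image_iff_linearCombination ℝ).2 ⟨g, ?_, rfl⟩
        rw [Finsupp.mem_supported']
        intro j hj
        obtain rfl : j = i := by simpa using hj
        exact Finsupp.notMem_support_iff.1 hig
      have hLI₃ : LinearIndependent ℝ ![b i₀, x, c • b i] := by
        rw [linearIndependent_triple_iff]
        intro p q r hpqr
        have hr : r = 0 := by
          by_contra hr
          refine b.linearIndependent.notMem_span_image (s := {i}ᶜ) (x := i) (by simp) ?_
          rw [← Submodule.smul_mem_iff _ (mul_ne_zero hr hc), mul_smul,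
            eq_neg_of_add_eq_zero_right hpqr]
          exact Submodule.neg_mem _ (Submodule.add_mem _ (Submodule.smul_mem _ _ hi₀mem)
            (Submodule.smul_mem _ _ hxmem))
        rw [hr, zero_smul, add_zero] at hpqr
        obtain ⟨hp, hq⟩ := LinearIndependent.pair_iff.1 hLI p q hpqr
        exact ⟨hp, hq, hr⟩
      rw [_root_.map_add]
      refine h.signEq_add_of_triple hLI₃ (u := A (b i₀)) ?_ (ih t) ?_ ?_ ?_
      · rw [hA]
        exact hf i₀
      · simpa using hline i 0 c
      · rw [← _root_.map_add, show b i₀ + x = (1 + t) • b i₀ + Finsupp.linearCombination ℝ b g by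
          rw [hx]; module]
        exact ih _
      · rw [← _root_.map_add]
        simpa using hline i 1 c
  refine ⟨A, fun x => ?_⟩
  simpa using key (b.repr x) 0

end IsTermwiseSignLinear

theorem IsNNorm.isTermwiseSignLinear {n : ℕ} (hn : 3 ≤ n) {X Y : Type*} [AddCommGroup X]
    [Module ℝ X] [AddCommGroup Y] [Module ℝ Y] {N : (Fin n → X) → ℝ} {M : (Fin n → Y) → ℝ}
    (hN : IsNNorm n X N) (hM : IsNNorm n Y M) (hX : (n : Cardinal) ≤ Module.rank ℝ X) {φ : X → Y}
    (hφ : ∀ x : Fin n → X, M (fun i => φ (x i)) = N x) : IsTermwiseSignLinear φ where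
  map_smul c x := by
    obtain ⟨s, hs, h⟩ := map_smul_eq hN hM hφ hX (by omega) c x
    exact ⟨s, hs, by rw [h, mul_smul]⟩
  map_add hxy := map_add_eq hN hM hφ hX hn hxy
  linearIndependent_pair {x y} hxy := by
    have h := linearIndependent_map_of_le hN hM hφ hX (show 2 ≤ n by omega) hxy
    convert h using 1
    ext i
    fin_cases i <;> rfl
  linearIndependent_triple {x y z} hxyz := by
    have h := linearIndependent_map_of_le hN hM hφ hX hn hxyz
    convert h using 1
    ext i
    fin_cases i <;> rfl

/-- Every `n`-norm preserver between real `n`-normed spaces (`n ≥ 3`) is plus-minus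
linear: there is a linear map `A` with `φ x = A x` or `φ x = -A x` for every `x`. -/
theorem nNormPreserver_plusMinusLinear
    {n : ℕ} (hn : 3 ≤ n)
    {X Y : Type*} [AddCommGroup X] [Module ℝ X] [AddCommGroup Y] [Module ℝ Y]
    (NX : (Fin n → X) → ℝ) (NY : (Fin n → Y) → ℝ)
    (hNX : IsNNorm n X NX) (hNY : IsNNorm n Y NY)
    (hdX : (n : Cardinal) ≤ Module.rank ℝ X) (hdY : (n : Cardinal) ≤ Module.rank ℝ Y)
    (φ : X → Y)
    (hφ : ∀ x : Fin n → X, NY (fun i => φ (x i)) = NX x) :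
    ∃ A : X →ₗ[ℝ] Y, ∀ x : X, φ x = A x ∨ φ x = -(A x) := by
  have : Nontrivial X := by
    rw [← rank_pos_iff_nontrivial (R := ℝ)]
    exact lt_of_lt_of_le (by exact_mod_cast (by omega : 0 < n)) hdX
  obtain ⟨A, hA⟩ := (hNX.isTermwiseSignLinear hn hNY hdX hφ).exists_linearMap
  exact ⟨A, fun x => (hA x).eq_or_eq_neg⟩
end

section
/- Let X be a two-dimensional real vector space, let N be a 2-norm on X, and let x₁, x₂ be a basis of X. Then for all real numbers α₁, α₂, β₁, β₂ one has N(α₁·x₁ + α₂·x₂, β₁·x₁ + β₂·x₂) = |α₁·β₂ − α₂·β₁| · N(x₁, x₂). In particular, every 2-norm on a two-dimensional real vector space is a positive scalar multiple of the absolute value of the coordinate determinant with respect to any fixed basis. -/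
theorem update_vecCons_zero {X : Type*} {n : ℕ} (u w : X) (v : Fin n → X) :
    Function.update (Matrix.vecCons u v) 0 w = Matrix.vecCons w v :=
  Fin.update_cons_zero (α := fun _ => X) u v w

namespace IsNNorm

variable {X : Type*} [AddCommGroup X] [Module ℝ X] {N : (Fin 2 → X) → ℝ}

theorem two_comm (hN : IsNNorm 2 X N) (u v : X) : N ![u, v] = N ![v, u] := by
  rw [← hN.perm ![v, u] (Equiv.swap 0 1)]
  congr 1
  ext i
  fin_cases i <;> simp

theorem two_self (hN : IsNNorm 2 X N) (v : X) : N ![v, v] = 0 := by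
  rw [hN.eq_zero_iff]
  intro h
  exact zero_ne_one (h.injective (a₁ := (0 : Fin 2)) (a₂ := 1) rfl)

theorem two_smul_left (hN : IsNNorm 2 X N) (c : ℝ) (u v : X) :
    N ![c • u, v] = |c| * N ![u, v] := by
  simpa [update_vecCons_zero] using hN.smul ![u, v] 0 c

theorem two_smul_right (hN : IsNNorm 2 X N) (c : ℝ) (u v : X) :
    N ![u, c • v] = |c| * N ![u, v] := by
  rw [hN.two_comm, hN.two_smul_left, hN.two_comm]

theorem two_add_left_le (hN : IsNNorm 2 X N) (u w v : X) :
    N ![u + w, v] ≤ N ![u, v] + N ![w, v] := by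
  simpa [update_vecCons_zero] using hN.add_le ![u, v] 0 w

theorem two_add_smul_left_le (hN : IsNNorm 2 X N) (c : ℝ) (u v : X) :
    N ![u + c • v, v] ≤ N ![u, v] := by
  simpa [hN.two_smul_left, hN.two_self] using hN.two_add_left_le u (c • v) v

/-- A 2-norm is invariant under shears. -/
theorem two_add_smul_left (hN : IsNNorm 2 X N) (c : ℝ) (u v : X) :
    N ![u + c • v, v] = N ![u, v] := by
  refine le_antisymm (hN.two_add_smul_left_le c u v) ?_
  simpa using hN.two_add_smul_left_le (-c) (u + c • v) v

theorem two_add_smul_right (hN : IsNNorm 2 X N) (c : ℝ) (u v : X) :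
    N ![u, v + c • u] = N ![u, v] := by
  rw [hN.two_comm, hN.two_add_smul_left, hN.two_comm]

end IsNNorm

/-- In a two-dimensional real vector space, every 2-norm is, in the coordinates of any
basis `x₁, x₂`, the absolute value of the coordinate determinant times `N (x₁, x₂)`. -/
theorem twoNorm_eq_abs_det_mul
    {X : Type*} [AddCommGroup X] [Module ℝ X]
    (hdX : Module.finrank ℝ X = 2)
    (N : (Fin 2 → X) → ℝ) (hN : IsNNorm 2 X N)
    (x₁ x₂ : X) (hx : LinearIndependent ℝ ![x₁, x₂])
    (α₁ α₂ β₁ β₂ : ℝ) :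
    N ![α₁ • x₁ + α₂ • x₂, β₁ • x₁ + β₂ • x₂] = |α₁ * β₂ - α₂ * β₁| * N ![x₁, x₂] := by
  rcases eq_or_ne α₁ 0 with rfl | hα
  · rw [zero_smul, zero_add, hN.two_smul_left, hN.two_comm, hN.two_add_smul_left,
      hN.two_smul_left, ← mul_assoc, ← abs_mul, zero_mul, zero_sub, abs_neg]
  · have key : β₁ • x₁ + β₂ • x₂ =
        ((α₁ * β₂ - α₂ * β₁) / α₁) • x₂ + (β₁ / α₁) • (α₁ • x₁ + α₂ • x₂) := by
      match_scalars <;> field_simp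
      ring
    rw [key, hN.two_add_smul_right, hN.two_smul_right, hN.two_add_smul_left,
      hN.two_smul_left, ← mul_assoc, ← abs_mul, div_mul_cancel₀ _ hα]
end

section
/- Let n ≥ 2, let X and Y be real n-normed spaces with n-norms N_X and N_Y, and let φ : X → Y satisfy the (nDOPP) property: for all x₀,x₁,…,xₙ ∈ X, if N_X(x₁−x₀,…,xₙ−x₀) = 1 then N_Y(φ(x₁)−φ(x₀),…,φ(xₙ)−φ(x₀)) = 1. Then: (i) for every 2 ≤ k ≤ n, whenever x₀,…,x_{k−1} ∈ X are affinely independent, the images φ(x₀),…,φ(x_{k−1}) are affinely independent; (ii) φ is injective; (iii) the range of φ is not contained in any affine line of Y. -/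
/-- A linearly independent family indexed by `Fin m` extends to one indexed by `Fin n`
whenever `m ≤ n ≤ rank`. -/
theorem LinearIndependent.exists_fin_extend {X : Type*} [AddCommGroup X] [Module ℝ X]
    {m n : ℕ} (hmn : m ≤ n) (hn : (n : Cardinal) ≤ Module.rank ℝ X)
    {v : Fin m → X} (hv : LinearIndependent ℝ v) :
    ∃ w : Fin n → X, LinearIndependent ℝ w ∧ ∀ i, w (Fin.castLE hmn i) = v i := by
  induction n, hmn using Nat.le_induction with
  | base => exact ⟨v, hv, fun _ => rfl⟩
  | succ k hk ih =>
    obtain ⟨w, hw, hwv⟩ := ih (le_trans (by exact_mod_cast k.le_succ) hn)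
    obtain ⟨y, hy⟩ := exists_linearIndependent_snoc_of_lt_rank hw
      (lt_of_lt_of_le (by exact_mod_cast k.lt_succ_self) hn)
    refine ⟨Fin.snoc w y, hy, fun i => ?_⟩
    rw [← hwv i]
    exact Fin.snoc_castSucc (α := fun _ => X) y w (Fin.castLE hk i)

/-- Affine independence of a family indexed by `Fin (m + 1)`, tested by the differences
from the first point. -/
theorem affineIndependent_fin_succ_iff {X : Type*} [AddCommGroup X] [Module ℝ X] {m : ℕ}
    (x : Fin (m + 1) → X) :
    AffineIndependent ℝ x ↔ LinearIndependent ℝ (fun i : Fin m => x i.succ - x 0) := by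
  rw [affineIndependent_iff_linearIndependent_vsub ℝ x 0,
    ← linearIndependent_equiv (finSuccAboveEquiv (0 : Fin (m + 1)))]
  rfl

/-- Up to `n` affinely independent points extend to `n + 1` points whose differences from
the first one have unit `n`-norm. -/
theorem IsNNorm.exists_extend_eq_one {n m : ℕ} {X : Type*} [AddCommGroup X] [Module ℝ X]
    {N : (Fin n → X) → ℝ} (hN : IsNNorm n X N) (hn : (n : Cardinal) ≤ Module.rank ℝ X)
    (hmn : m + 1 ≤ n) {x : Fin (m + 1) → X} (hx : AffineIndependent ℝ x) :
    ∃ y : Fin (n + 1) → X, N (fun i : Fin n => y i.succ - y 0) = 1 ∧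
      ∀ i, y (Fin.castLE (hmn.trans n.le_succ) i) = x i := by
  obtain ⟨w, hw, hwv⟩ := ((affineIndependent_fin_succ_iff x).1 hx).exists_fin_extend
    (m.le_succ.trans hmn) hn
  have hpos : 0 < N w :=
    lt_of_le_of_ne (hN.nonneg w) fun h => (hN.eq_zero_iff w).1 h.symm hw
  let j : Fin n := ⟨m, hmn⟩
  refine ⟨Fin.cons (x 0) fun i => Function.update w j ((N w)⁻¹ • w j) i + x 0, ?_, ?_⟩
  · simp only [Fin.cons_succ, Fin.cons_zero, add_sub_cancel_right]
    rw [hN.smul, abs_of_pos (inv_pos.2 hpos), inv_mul_cancel₀ hpos.ne']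
  · intro i
    refine Fin.cases rfl (fun i => ?_) i
    have hi : Fin.castLE (m.le_succ.trans hmn) i ≠ j := fun h =>
      i.isLt.ne (congrArg Fin.val h)
    change Function.update w j ((N w)⁻¹ • w j) (Fin.castLE (m.le_succ.trans hmn) i) + x 0 =
      x i.succ
    rw [Function.update_of_ne hi, hwv, sub_add_cancel]

/-- An `n`DOPP map between real `n`-normed spaces (`n ≥ 2`) preserves affine
independence of `k` points (`2 ≤ k ≤ n`), is injective, and its range is not
contained in any affine line. -/
theorem nDOPP_affineIndependent_injective_range
    {n : ℕ} (hn : 2 ≤ n)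
    {X Y : Type*} [AddCommGroup X] [Module ℝ X] [AddCommGroup Y] [Module ℝ Y]
    (NX : (Fin n → X) → ℝ) (NY : (Fin n → Y) → ℝ)
    (hNX : IsNNorm n X NX) (hNY : IsNNorm n Y NY)
    (hdX : (n : Cardinal) ≤ Module.rank ℝ X) (hdY : (n : Cardinal) ≤ Module.rank ℝ Y)
    (φ : X → Y)
    (hφ : ∀ x : Fin (n + 1) → X,
      NX (fun i : Fin n => x i.succ - x 0) = 1 →
      NY (fun i : Fin n => φ (x i.succ) - φ (x 0)) = 1) :
    (∀ k : ℕ, 2 ≤ k → k ≤ n → ∀ x : Fin k → X,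
      AffineIndependent ℝ x → AffineIndependent ℝ (fun i => φ (x i))) ∧
    Function.Injective φ ∧
    ¬ Collinear ℝ (Set.range φ) := by
  have exists_image_indep : ∀ m : ℕ, ∀ hm : m + 1 ≤ n, ∀ x : Fin (m + 1) → X, AffineIndependent ℝ x →
      ∃ y : Fin (n + 1) → X, AffineIndependent ℝ (fun i => φ (y i)) ∧
        ∀ i, y (Fin.castLE (hm.trans n.le_succ) i) = x i := by
    intro m hm x hx
    obtain ⟨y, hy, hyx⟩ := hNX.exists_extend_eq_one hdX hm hx
    refine ⟨y, (affineIndependent_fin_succ_iff _).2 ?_, hyx⟩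
    by_contra h
    exact one_ne_zero ((hφ y hy).symm.trans ((hNY.eq_zero_iff _).2 h))
  have indep : ∀ k : ℕ, 2 ≤ k → k ≤ n → ∀ x : Fin k → X,
      AffineIndependent ℝ x → AffineIndependent ℝ (fun i => φ (x i)) := by
    rintro (_ | m) hk hkn x hx
    · omega
    · obtain ⟨y, hy, hyx⟩ := exists_image_indep m hkn x hx
      simpa only [Function.comp_def, Fin.castLEEmb_apply, hyx] using
        hy.comp_embedding (Fin.castLEEmb (hkn.trans n.le_succ))
  refine ⟨indep, fun a b hab => ?_, fun hcol => ?_⟩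
  · by_contra hne
    have h := (indep 2 le_rfl hn ![a, b] (affineIndependent_of_ne ℝ hne)).injective
    exact zero_ne_one (h (a₁ := 0) (a₂ := 1) hab)
  · obtain ⟨y, hy, -⟩ := exists_image_indep 0 (by omega) (fun _ => 0)
      ((affineIndependent_fin_succ_iff _).2 linearIndependent_empty_type)
    have h3 := hy.comp_embedding (Fin.castLEEmb (show 3 ≤ n + 1 by omega))
    refine affineIndependent_iff_not_collinear.1 h3 (hcol.subset ?_)
    rintro _ ⟨i, rfl⟩
    exact ⟨_, rfl⟩
end

section
/- Let n ≥ 2, let X and Y be real n-normed spaces with n-norms N_X and N_Y, and let φ : X → Y be a lineation satisfying the (nDOPP) property: for all x₀,x₁,…,xₙ ∈ X, if N_X(x₁−x₀,…,xₙ−x₀) = 1 then N_Y(φ(x₁)−φ(x₀),…,φ(xₙ)−φ(x₀)) = 1. Then φ is affine (it preserves all affine combinations: φ(t·x + (1−t)·y) = t·φ(x) + (1−t)·φ(y) for all x,y ∈ X, t ∈ ℝ) and φ is an n-isometry. -/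
namespace IsNNorm

variable {n : ℕ} {X : Type*} [AddCommGroup X] [Module ℝ X] {N : (Fin n → X) → ℝ}

theorem ne_zero_iff (hN : IsNNorm n X N) {v : Fin n → X} : N v ≠ 0 ↔ LinearIndependent ℝ v := by
  rw [ne_eq, hN.eq_zero_iff, not_not]

theorem update_smul_eq_zero (hN : IsNNorm n X N) (v : Fin n → X) {i j : Fin n} (hij : i ≠ j)
    (a : ℝ) : N (Function.update v j (a • v i)) = 0 := by
  have h0 : N (Function.update v j (v i)) = 0 :=
    (hN.eq_zero_iff _).2 fun h => hij (h.injective (by simp [hij]))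
  simpa [h0] using hN.smul (Function.update v j (v i)) j a

/-- An `n`-norm is invariant under shears. -/
theorem update_add_smul (hN : IsNNorm n X N) (v : Fin n → X) {i j : Fin n} (hij : i ≠ j)
    (a : ℝ) : N (Function.update v j (v j + a • v i)) = N v := by
  apply le_antisymm
  · simpa [hN.update_smul_eq_zero v hij] using hN.add_le v j (a • v i)
  · have h := hN.add_le (Function.update v j (v j + a • v i)) j (-a • v i)
    have h0 := hN.update_smul_eq_zero v hij (-a)
    simp only [Function.update_self, Function.update_idem, h0, add_zero] at h
    simpa using h

theorem update_smul_add_smul (hN : IsNNorm n X N) (v : Fin n → X) {i j : Fin n} (hij : i ≠ j)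
    (a b : ℝ) : N (Function.update v j (a • v i + b • v j)) = |b| * N v := by
  rw [← hN.smul v j b, ← hN.update_add_smul (Function.update v j (b • v j)) hij a]
  simp [hij, add_comm]

theorem update_inv_smul (hN : IsNNorm n X N) {v : Fin n → X} (hv : LinearIndependent ℝ v)
    (i : Fin n) : N (Function.update v i ((N v)⁻¹ • v i)) = 1 := by
  rw [hN.smul, abs_inv, abs_of_nonneg (hN.nonneg v), inv_mul_cancel₀ (hN.ne_zero_iff.2 hv)]

end IsNNorm

theorem exists_linearIndependent_extending_pair {X : Type*} [AddCommGroup X] [Module ℝ X] {n : ℕ}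
    (hn : 2 ≤ n) (hd : (n : Cardinal) ≤ Module.rank ℝ X) {x y : X}
    (hxy : LinearIndependent ℝ ![x, y]) :
    ∃ v : Fin n → X, LinearIndependent ℝ v ∧ ∃ i j, i ≠ j ∧ v i = x ∧ v j = y := by
  induction n, hn using Nat.le_induction with
  | base => exact ⟨_, hxy, 0, 1, by simp⟩
  | succ n hn ih =>
    have hlt : (n : Cardinal) < Module.rank ℝ X :=
      lt_of_lt_of_le (by exact_mod_cast n.lt_succ_self) hd
    obtain ⟨v, hv, i, j, hij, hi, hj⟩ := ih hlt.le
    obtain ⟨z, hz⟩ := exists_linearIndependent_snoc_of_lt_rank hv hlt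
    exact ⟨_, hz, i.castSucc, j.castSucc, by simpa using hij, by simpa using hi, by simpa using hj⟩

/-- A map sending three collinear points to collinear points sends points of the line through `p`
and `q` to points of the line through their images, if these are distinct. -/
theorem exists_eq_add_smul_sub_of_collinear {X Y : Type*} [AddCommGroup X] [Module ℝ X]
    [AddCommGroup Y] [Module ℝ Y] {φ : X → Y}
    (hlin : ∀ p q r : X, Collinear ℝ ({p, q, r} : Set X) →
      Collinear ℝ ({φ p, φ q, φ r} : Set Y)) {p q : X} (hpq : φ p ≠ φ q) (t : ℝ) :
    ∃ k : ℝ, φ (p + t • (q - p)) = φ p + k • (φ q - φ p) := by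
  have hX : Collinear ℝ ({p, q, p + t • (q - p)} : Set X) := by
    rw [collinear_iff_of_mem (p₀ := p) (by simp)]
    refine ⟨q - p, ?_⟩
    rintro r (rfl | rfl | rfl)
    · exact ⟨0, by simp⟩
    · exact ⟨1, by simp⟩
    · exact ⟨t, by simp [add_comm]⟩
  obtain ⟨w, hw⟩ := (collinear_iff_of_mem (p₀ := φ p) (by simp)).1 (hlin _ _ _ hX)
  obtain ⟨a, ha⟩ := hw (φ q) (by simp)
  obtain ⟨b, hb⟩ := hw (φ (p + t • (q - p))) (by simp)
  have ha0 : a ≠ 0 := by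
    rintro rfl
    exact hpq (by simpa using ha.symm)
  refine ⟨b / a, ?_⟩
  rw [hb, ha]
  simp [smul_smul, div_mul_cancel₀ _ ha0, add_comm]

theorem injective_of_nDOPP {n : ℕ} (hn : 2 ≤ n) {X Y : Type*} [AddCommGroup X] [Module ℝ X]
    [AddCommGroup Y] [Module ℝ Y] {NX : (Fin n → X) → ℝ} {NY : (Fin n → Y) → ℝ}
    (hNX : IsNNorm n X NX) (hNY : IsNNorm n Y NY) (hdX : (n : Cardinal) ≤ Module.rank ℝ X)
    {φ : X → Y}
    (hφ : ∀ (a : X) (v : Fin n → X), NX v = 1 → NY (fun i => φ (a + v i) - φ a) = 1) :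
    Function.Injective φ := by
  intro p q hpq
  by_contra hne
  have hr : 1 < Module.rank ℝ X :=
    lt_of_lt_of_le (by exact_mod_cast (show 1 < n by omega)) hdX
  obtain ⟨y, hy⟩ := exists_linearIndependent_pair_of_one_lt_rank hr (sub_ne_zero.2 (Ne.symm hne))
  obtain ⟨v, hv, i, j, hij, hi, -⟩ := exists_linearIndependent_extending_pair hn hdX hy
  have h1 := hφ p _ (hNX.update_inv_smul hv j)
  have h2 := hNY.ne_zero_iff.1 (h1.symm ▸ one_ne_zero)
  exact h2.ne_zero i (by simp [hij, hi, hpq])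

section Linear

variable {n : ℕ} {X Y : Type*} [AddCommGroup X] [Module ℝ X] [AddCommGroup Y] [Module ℝ Y]
  {NX : (Fin n → X) → ℝ} {NY : (Fin n → Y) → ℝ} {T : X → Y}

theorem exists_map_smul_eq (h0 : T 0 = 0)
    (hline : ∀ p q : X, p ≠ q → ∀ t : ℝ, ∃ k : ℝ, T (p + t • (q - p)) = T p + k • (T q - T p))
    (x : X) (t : ℝ) : ∃ k : ℝ, T (t • x) = k • T x := by
  by_cases hx : x = 0
  · exact ⟨0, by simp [hx, h0]⟩
  · simpa [h0] using hline 0 x (Ne.symm hx) t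

theorem exists_map_inv_smul_eq (h0 : T 0 = 0) (hNX : IsNNorm n X NX) (hNY : IsNNorm n Y NY)
    (hline : ∀ p q : X, p ≠ q → ∀ t : ℝ, ∃ k : ℝ, T (p + t • (q - p)) = T p + k • (T q - T p))
    (hT : ∀ v : Fin n → X, NX v = 1 → NY (T ∘ v) = 1) {v : Fin n → X}
    (hv : LinearIndependent ℝ v) (i : Fin n) :
    ∃ k : ℝ, T ((NX v)⁻¹ • v i) = k • T (v i) ∧ |k| * NY (T ∘ v) = 1 := by
  obtain ⟨k, hk⟩ := exists_map_smul_eq h0 hline (v i) (NX v)⁻¹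
  refine ⟨k, hk, ?_⟩
  rw [← hNY.smul (T ∘ v) i k, ← hT _ (hNX.update_inv_smul hv i), Function.comp_update, hk]
  rfl

theorem linearIndependent_comp (h0 : T 0 = 0) (hn : 0 < n) (hNX : IsNNorm n X NX)
    (hNY : IsNNorm n Y NY)
    (hline : ∀ p q : X, p ≠ q → ∀ t : ℝ, ∃ k : ℝ, T (p + t • (q - p)) = T p + k • (T q - T p))
    (hT : ∀ v : Fin n → X, NX v = 1 → NY (T ∘ v) = 1) {v : Fin n → X}
    (hv : LinearIndependent ℝ v) : LinearIndependent ℝ (T ∘ v) := by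
  obtain ⟨k, -, hk⟩ := exists_map_inv_smul_eq h0 hNX hNY hline hT hv ⟨0, hn⟩
  rw [← hNY.ne_zero_iff]
  intro h
  simp [h] at hk

theorem exists_map_add_eq (h0 : T 0 = 0) (hNX : IsNNorm n X NX) (hNY : IsNNorm n Y NY)
    (hline : ∀ p q : X, p ≠ q → ∀ t : ℝ, ∃ k : ℝ, T (p + t • (q - p)) = T p + k • (T q - T p))
    (hT : ∀ v : Fin n → X, NX v = 1 → NY (T ∘ v) = 1) {v : Fin n → X}
    (hv : LinearIndependent ℝ v) {i j : Fin n} (hij : i ≠ j) :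
    ∃ a b : ℝ, |b| = 1 ∧ T (v i + v j) = a • T (v i) + b • T (v j) := by
  obtain ⟨a, b, hab⟩ : ∃ a b : ℝ, T (v i + v j) = a • T (v i) + b • T (v j) := by
    obtain ⟨k, hk⟩ := exists_map_smul_eq h0 hline (v i) 2
    obtain ⟨l, hl⟩ := exists_map_smul_eq h0 hline (v j) 2
    have hne : (2 : ℝ) • v i ≠ (2 : ℝ) • v j := fun h =>
      hij (hv.injective (smul_right_injective X two_ne_zero h))
    obtain ⟨m, hm⟩ := hline _ _ hne (1 / 2)
    refine ⟨k - m * k, m * l, ?_⟩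
    have : v i + v j = (2 : ℝ) • v i + (1 / 2 : ℝ) • ((2 : ℝ) • v j - (2 : ℝ) • v i) := by module
    rw [this, hm, hk, hl]
    module
  refine ⟨a, b, ?_, hab⟩
  obtain ⟨k, hk, hk1⟩ := exists_map_inv_smul_eq h0 hNX hNY hline hT hv i
  have h1 : NX (Function.update (Function.update v j (v i + v j)) i ((NX v)⁻¹ • v i)) = 1 := by
    have h2 := hNX.smul (Function.update v j (v i + v j)) i (NX v)⁻¹
    have h3 := hNX.update_smul_add_smul v hij 1 1
    simp only [one_smul, abs_one, one_mul] at h3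
    rw [Function.update_of_ne hij, h3, abs_inv, abs_of_nonneg (hNX.nonneg v),
      inv_mul_cancel₀ (hNX.ne_zero_iff.2 hv)] at h2
    exact h2
  have h2 := hT _ h1
  rw [Function.comp_update, Function.comp_update, hk, hab] at h2
  have h3 := hNY.smul (Function.update (T ∘ v) j (a • T (v i) + b • T (v j))) i k
  have h4 := hNY.update_smul_add_smul (T ∘ v) hij a b
  simp only [Function.comp_apply] at h4
  rw [Function.update_of_ne hij, h4, Function.comp_apply, h2] at h3
  linear_combination -|b| * hk1 - h3

theorem exists_map_add_eq_smul_add (h0 : T 0 = 0) (hinj : Function.Injective T)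
    (hNX : IsNNorm n X NX) (hNY : IsNNorm n Y NY)
    (hline : ∀ p q : X, p ≠ q → ∀ t : ℝ, ∃ k : ℝ, T (p + t • (q - p)) = T p + k • (T q - T p))
    (hT : ∀ v : Fin n → X, NX v = 1 → NY (T ∘ v) = 1) {v : Fin n → X}
    (hv : LinearIndependent ℝ v) {i j : Fin n} (hij : i ≠ j) :
    ∃ a : ℝ, T (v i + v j) = a • T (v i) + T (v j) := by
  obtain ⟨a, b, hb, hab⟩ := exists_map_add_eq h0 hNX hNY hline hT hv hij
  rcases (abs_eq zero_le_one).1 hb with rfl | rfl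
  · exact ⟨a, by simpa using hab⟩
  exfalso
  have hvi := hv.ne_zero i
  have hv' : LinearIndependent ℝ (Function.update v i ((2 : ℝ) • v i)) := by
    rw [← hNX.ne_zero_iff, hNX.smul]
    simpa using hNX.ne_zero_iff.2 hv
  obtain ⟨c, d, hd, hcd⟩ := exists_map_add_eq h0 hNX hNY hline hT hv' hij
  rw [Function.update_self, Function.update_of_ne hij.symm] at hcd
  obtain ⟨l, hl⟩ := exists_map_smul_eq h0 hline (v i) 2
  obtain ⟨k, hk⟩ := hline (v j) (v i + v j) (by simpa using hvi) 2
  have he : v j + (2 : ℝ) • (v i + v j - v j) = (2 : ℝ) • v i + v j := by module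
  have hind : LinearIndependent ℝ ![T (v i), T (v j)] := by
    have := (linearIndependent_comp h0 i.pos hNX hNY hline hT hv).comp ![i, j] (by
      intro r s; fin_cases r <;> fin_cases s <;> simp [hij, hij.symm])
    convert this using 1
    ext r; fin_cases r <;> rfl
  rw [he] at hk
  have hd' : d = 1 - 2 * k := by
    have h3 : (c * l - k * a) • T (v i) + (d - (1 - 2 * k)) • T (v j) = 0 := by
      have h4 := hcd.symm.trans hk
      rw [hl, hab] at h4
      linear_combination (norm := module) h4
    linarith [(LinearIndependent.pair_iff.1 hind _ _ h3).2]
  rcases (abs_eq zero_le_one).1 hd with rfl | rfl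
  · obtain rfl : k = 0 := by linarith
    have := hinj (hk.trans (by simp : _ = T (v j)))
    simp [hvi] at this
  · obtain rfl : k = 1 := by linarith
    have := hinj (hk.trans (by simp : _ = T (v i + v j)))
    simp only [two_smul, add_left_inj, add_eq_left] at this
    exact hvi this

theorem map_add_of_linearIndependent (h0 : T 0 = 0) (hinj : Function.Injective T)
    (hn : 2 ≤ n) (hdX : (n : Cardinal) ≤ Module.rank ℝ X)
    (hNX : IsNNorm n X NX) (hNY : IsNNorm n Y NY)
    (hline : ∀ p q : X, p ≠ q → ∀ t : ℝ, ∃ k : ℝ, T (p + t • (q - p)) = T p + k • (T q - T p))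
    (hT : ∀ v : Fin n → X, NX v = 1 → NY (T ∘ v) = 1) {x y : X}
    (hxy : LinearIndependent ℝ ![x, y]) :
    LinearIndependent ℝ ![T x, T y] ∧ T (x + y) = T x + T y := by
  obtain ⟨v, hv, i, j, hij, rfl, rfl⟩ := exists_linearIndependent_extending_pair hn hdX hxy
  have hind : LinearIndependent ℝ ![T (v i), T (v j)] := by
    have := (linearIndependent_comp h0 i.pos hNX hNY hline hT hv).comp ![i, j] (by
      intro r s; fin_cases r <;> fin_cases s <;> simp [hij, hij.symm])
    convert this using 1
    ext r; fin_cases r <;> rfl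
  refine ⟨hind, ?_⟩
  obtain ⟨a, ha⟩ := exists_map_add_eq_smul_add h0 hinj hNX hNY hline hT hv hij
  obtain ⟨b, hb⟩ := exists_map_add_eq_smul_add h0 hinj hNX hNY hline hT hv hij.symm
  rw [add_comm] at hb
  have h : (a - 1) • T (v i) + (1 - b) • T (v j) = 0 := by
    have h4 := ha.symm.trans hb
    linear_combination (norm := module) h4
  obtain rfl : a = 1 := by linarith [(LinearIndependent.pair_iff.1 hind _ _ h).1]
  simpa using ha

theorem map_add_of_map_add_of_linearIndependent {X Y : Type*} [AddCommGroup X] [Module ℝ X]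
    [AddCommGroup Y] {T : X → Y} (h0 : T 0 = 0) (hd : 1 < Module.rank ℝ X)
    (hadd : ∀ x y : X, LinearIndependent ℝ ![x, y] → T (x + y) = T x + T y) (x y : X) :
    T (x + y) = T x + T y := by
  by_cases hxy : LinearIndependent ℝ ![x, y]
  · exact hadd x y hxy
  by_cases hx : x = 0
  · simp [hx, h0]
  rw [LinearIndependent.pair_iff' hx] at hxy
  push Not at hxy
  obtain ⟨c, rfl⟩ := hxy
  obtain ⟨u, hu⟩ := exists_linearIndependent_pair_of_one_lt_rank hd hx
  have key : ∀ a : ℝ, T (a • x + u) = T (a • x) + T u := fun a => by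
    by_cases ha : a = 0
    · simp [ha, h0]
    · refine hadd _ _ ?_
      rw [LinearIndependent.pair_iff] at hu ⊢
      intro s t hst
      have := hu (s * a) t (by rw [mul_smul]; exact hst)
      simpa [ha] using this
  have h1 := key (1 + c)
  have h2 : T (x + (c • x + u)) = T x + T (c • x + u) := by
    refine hadd _ _ ?_
    rw [LinearIndependent.pair_iff] at hu ⊢
    intro s t hst
    have := hu (s + t * c) t (by rw [← hst]; module)
    obtain ⟨h3, rfl⟩ := this
    simpa using h3
  rw [key c, ← add_assoc, ← add_assoc] at h2
  rw [add_smul, one_smul, h2] at h1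
  exact (add_right_cancel h1).symm

theorem map_smul_of_map_add (hd : 1 < Module.rank ℝ X) (hadd : ∀ x y : X, T (x + y) = T x + T y)
    (hsmul : ∀ (x : X) (t : ℝ), ∃ k : ℝ, T (t • x) = k • T x)
    (hind : ∀ x y : X, LinearIndependent ℝ ![x, y] → LinearIndependent ℝ ![T x, T y])
    (t : ℝ) (x : X) : T (t • x) = t • T x := by
  have h0 : T 0 = 0 := by simpa using hadd 0 0
  have hpair : ∀ x y : X, LinearIndependent ℝ ![x, y] → ∀ t a : ℝ,
      T (t • x) = a • T x → T (t • y) = a • T y := by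
    intro x y hxy t a ha
    obtain ⟨b, hb⟩ := hsmul y t
    obtain ⟨c, hc⟩ := hsmul (x + y) t
    rw [smul_add, hadd, hadd, ha, hb] at hc
    have h := LinearIndependent.pair_iff.1 (hind x y hxy) (a - c) (b - c) (by
      linear_combination (norm := module) hc)
    rw [hb, show b = a by linarith [h.1, h.2]]
  obtain ⟨e, he⟩ : ∃ e : X, e ≠ 0 :=
    have := rank_pos_iff_nontrivial.1 (zero_lt_one.trans hd)
    exists_ne 0
  obtain ⟨u, hu⟩ := exists_linearIndependent_pair_of_one_lt_rank hd he
  have hTe : T e ≠ 0 := (hind e u hu).ne_zero 0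
  choose f hf using hsmul e
  have hall : ∀ (t : ℝ) (v : X), T (t • v) = f t • T v := by
    intro t v
    by_cases hv : v = 0
    · simp [hv, h0]
    by_cases hev : LinearIndependent ℝ ![e, v]
    · exact hpair e v hev t _ (hf t)
    rw [LinearIndependent.pair_iff' he] at hev
    push Not at hev
    obtain ⟨c, rfl⟩ := hev
    refine hpair u _ ?_ t _ (hpair e u hu t _ (hf t))
    have hc : c ≠ 0 := by
      rintro rfl
      simp at hv
    rw [LinearIndependent.pair_iff] at hu ⊢
    intro r s hrs
    have := hu (s * c) r (by rw [← hrs]; module)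
    simpa [hc, and_comm] using this
  have hcancel : ∀ a b : ℝ, a • T e = b • T e → a = b := fun a b h =>
    smul_left_injective ℝ hTe h
  let F : ℝ →+* ℝ :=
    { toFun := f
      map_one' := hcancel _ _ (by rw [← hf]; simp)
      map_mul' := fun a b => hcancel _ _ (by rw [← hf, mul_smul, hall, hf, mul_smul])
      map_zero' := hcancel _ _ (by rw [← hf]; simp [h0])
      map_add' := fun a b => hcancel _ _ (by rw [← hf, add_smul, hadd, hf, hf, add_smul]) }
  have hF : F = RingHom.id ℝ := Subsingleton.elim _ _
  rw [hall, show f t = t from congrArg (fun G : ℝ →+* ℝ => G t) hF]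

end Linear

/-- A lineation between real `n`-normed spaces (`n ≥ 2`) satisfying the `n`DOPP
property is affine and an `n`-isometry. -/
theorem nDOPP_lineation_affine_nIsometry
    {n : ℕ} (hn : 2 ≤ n)
    {X Y : Type*} [AddCommGroup X] [Module ℝ X] [AddCommGroup Y] [Module ℝ Y]
    (NX : (Fin n → X) → ℝ) (NY : (Fin n → Y) → ℝ)
    (hNX : IsNNorm n X NX) (hNY : IsNNorm n Y NY)
    (hdX : (n : Cardinal) ≤ Module.rank ℝ X) (hdY : (n : Cardinal) ≤ Module.rank ℝ Y)
    (φ : X → Y)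
    (hlin : ∀ p q r : X, Collinear ℝ ({p, q, r} : Set X) →
      Collinear ℝ ({φ p, φ q, φ r} : Set Y))
    (hφ : ∀ x : Fin (n + 1) → X,
      NX (fun i : Fin n => x i.succ - x 0) = 1 →
      NY (fun i : Fin n => φ (x i.succ) - φ (x 0)) = 1) :
    (∀ (x y : X) (t : ℝ), φ (t • x + (1 - t) • y) = t • φ x + (1 - t) • φ y) ∧
    (∀ x : Fin (n + 1) → X,
      NY (fun i : Fin n => φ (x i.succ) - φ (x 0)) =
      NX (fun i : Fin n => x i.succ - x 0)) := by
  have hφ' : ∀ (a : X) (v : Fin n → X), NX v = 1 → NY (fun i => φ (a + v i) - φ a) = 1 := by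
    intro a v hv
    simpa using hφ (Fin.cons a fun i => a + v i) (by simpa using hv)
  have hd : 1 < Module.rank ℝ X :=
    lt_of_lt_of_le (by exact_mod_cast (show 1 < n by omega)) hdX
  have hinjφ := injective_of_nDOPP hn hNX hNY hdX hφ'
  set T : X → Y := fun x => φ x - φ 0 with hTdef
  have h0 : T 0 = 0 := sub_self _
  have hinj : Function.Injective T := fun x y h => hinjφ (sub_left_injective h)
  have hline : ∀ p q : X, p ≠ q → ∀ t : ℝ,
      ∃ k : ℝ, T (p + t • (q - p)) = T p + k • (T q - T p) := by
    intro p q hpq t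
    obtain ⟨k, hk⟩ := exists_eq_add_smul_sub_of_collinear hlin (hinjφ.ne hpq) t
    refine ⟨k, ?_⟩
    simp only [hTdef, hk]
    module
  have hT : ∀ v : Fin n → X, NX v = 1 → NY (T ∘ v) = 1 := fun v hv => by
    simpa [hTdef, Function.comp_def] using hφ' 0 v hv
  have hpair := fun x y hxy =>
    map_add_of_linearIndependent (x := x) (y := y) h0 hinj hn hdX hNX hNY hline hT hxy
  have hadd := map_add_of_map_add_of_linearIndependent h0 hd fun x y hxy => (hpair x y hxy).2
  have hsmul := map_smul_of_map_add hd hadd (exists_map_smul_eq h0 hline)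
    fun x y hxy => (hpair x y hxy).1
  have hφT : ∀ x, φ x = T x + φ 0 := fun x => (sub_add_cancel _ _).symm
  refine ⟨fun x y t => ?_, fun x => ?_⟩
  · rw [hφT, hφT x, hφT y, hadd, hsmul, hsmul]
    module
  · have hsub : ∀ p q : X, φ p - φ q = T (p - q) := fun p q => by
      rw [hφT p, ← sub_add_cancel p q, hadd, hφT q]
      simp
    simp only [hsub]
    set v : Fin n → X := fun i => x i.succ - x 0
    change NY (T ∘ v) = NX v
    by_cases hv : LinearIndependent ℝ v
    · have h1 := hT _ (hNX.update_inv_smul hv ⟨0, by omega⟩)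
      rw [Function.comp_update, hsmul] at h1
      have h2 := hNY.smul (T ∘ v) ⟨0, by omega⟩ (NX v)⁻¹
      rw [Function.comp_apply, h1, abs_inv, abs_of_nonneg (hNX.nonneg v)] at h2
      have h3 := hNX.ne_zero_iff.2 hv
      field_simp at h2
      exact h2.symm
    · let L : X →ₗ[ℝ] Y :=
        { toFun := T
          map_add' := hadd
          map_smul' := hsmul }
      rw [(hNX.eq_zero_iff v).2 hv, hNY.eq_zero_iff]
      exact fun h => hv (LinearIndependent.of_comp L h)
end

section
/- (Mazur–Ulam theorem for n-normed spaces.) Let n ≥ 2 and let X and Y be real n-normed spaces with n-norms N_X and N_Y. Then every n-isometry φ : X → Y is affine: φ(t·x + (1−t)·y) = t·φ(x) + (1−t)·φ(y) for all x, y ∈ X and t ∈ ℝ. -/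
/-- A linearly independent family `Fin k → V` with values in `S` can be prolonged to a linearly
independent family `Fin m → V` with values in `S`, provided `S` contains at least `m`
linearly independent vectors. -/
theorem LinearIndependent.exists_fin_extension {K V : Type*} [DivisionRing K] [AddCommGroup V]
    [Module K V] {S : Set V} {n : ℕ} {e : Fin n → V} (he : LinearIndependent K e)
    (heS : ∀ i, e i ∈ S) {k : ℕ} {f : Fin k → V} (hf : LinearIndependent K f)
    (hfS : ∀ i, f i ∈ S) {m : ℕ} (hkm : k ≤ m) (hmn : m ≤ n) :
    ∃ g : Fin m → V, LinearIndependent K g ∧ (∀ i, g i ∈ S) ∧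
      ∀ i : Fin k, g (Fin.castLE hkm i) = f i := by
  induction m, hkm using Nat.le_induction with
  | base => exact ⟨f, hf, hfS, fun _ => rfl⟩
  | succ m hkm ih =>
    obtain ⟨g, hg, hgS, hgf⟩ := ih (by omega)
    obtain ⟨i, hi⟩ : ∃ i, e i ∉ Submodule.span K (Set.range g) := by
      by_contra! h
      have := FiniteDimensional.span_of_finite K (Set.finite_range g)
      have hle := Submodule.finrank_mono (Submodule.span_le.2 (Set.range_subset_iff.2 h))
      rw [finrank_span_eq_card he, finrank_span_eq_card hg] at hle
      simp only [Fintype.card_fin] at hle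
      omega
    refine ⟨Fin.snoc g (e i), hg.finSnoc hi, fun j => ?_, fun j => ?_⟩
    · induction j using Fin.lastCases with
      | last => simpa using heS i
      | cast j => simpa using hgS j
    · rw [← hgf j]
      exact Fin.snoc_castSucc (α := fun _ => V) (e i) g (Fin.castLE hkm j)

/-- A map preserving `n`-norms of `n`-tuples preserves lines through the origin, and the
absolute value of ratios on them. -/
theorem IsNNorm.exists_map_smul_eq {n : ℕ} (hn : 2 ≤ n)
    {X Y : Type*} [AddCommGroup X] [Module ℝ X] [AddCommGroup Y] [Module ℝ Y]
    {NX : (Fin n → X) → ℝ} {NY : (Fin n → Y) → ℝ}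
    (hNX : IsNNorm n X NX) (hNY : IsNNorm n Y NY)
    (hdX : (n : Cardinal) ≤ Module.rank ℝ X) {ψ : X → Y}
    (hψ : ∀ u : Fin n → X, NY (fun i => ψ (u i)) = NX u) {v : X} (hv : v ≠ 0) (t : ℝ) :
    ψ v ≠ 0 ∧ ∃ s : ℝ, |s| = |t| ∧ ψ (t • v) = s • ψ v := by
  have hLI (u : Fin n → X) :
      LinearIndependent ℝ (fun i => ψ (u i)) ↔ LinearIndependent ℝ u := by
    rw [← not_iff_not, ← hNX.eq_zero_iff, ← hNY.eq_zero_iff, hψ]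
  obtain ⟨e, he⟩ : ∃ e : Fin n → X, LinearIndependent ℝ e := by
    obtain ⟨s, hs, hs'⟩ := le_rank_iff_exists_linearIndependent_finset.1 hdX
    exact ⟨_, hs'.comp _ (s.equivFinOfCardEq hs).symm.injective⟩
  obtain ⟨u, hu, -, huv⟩ := he.exists_fin_extension (S := Set.univ) (by simp)
    (f := ![v]) (linearIndependent_unique_iff.2 (by simpa using hv)) (by simp)
    (show 1 ≤ n by omega) le_rfl
  specialize huv 0
  simp only [Matrix.cons_val_zero] at huv
  set i₀ : Fin n := Fin.castLE (by omega) (0 : Fin 1)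
  have hψv : ψ v ≠ 0 := huv ▸ ((hLI u).2 hu).ne_zero i₀
  refine ⟨hψv, ?_⟩
  obtain ⟨s, hs⟩ : ∃ s : ℝ, s • ψ v = ψ (t • v) := by
    by_contra! h
    obtain ⟨g, hg, hgS, hgf⟩ := ((hLI e).2 he).exists_fin_extension (S := Set.range ψ) (by simp)
      ((LinearIndependent.pair_iff' hψv).2 h) (by simp) hn le_rfl
    choose w hw using hgS
    let w' : Fin n → X := fun i => if i.1 = 0 then v else if i.1 = 1 then t • v else w i
    have hw' : (fun i => ψ (w' i)) = g := by
      funext i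
      by_cases h0 : i.1 = 0
      · have : i = Fin.castLE hn 0 := Fin.ext h0
        rw [this, hgf]
        simp [w']
      · by_cases h1 : i.1 = 1
        · have : i = Fin.castLE hn 1 := Fin.ext h1
          rw [this, hgf]
          simp [w']
        · simp [w', h0, h1, hw]
    have hLw : LinearIndependent ℝ w' := (hLI w').1 (hw' ▸ hg)
    have hpair := hLw.comp (Fin.castLE hn) (Fin.castLE_injective hn)
    have : w' ∘ Fin.castLE hn = ![v, t • v] := by
      funext i
      fin_cases i <;> simp [w']
    rw [this] at hpair
    exact (LinearIndependent.pair_iff' hv).1 hpair t rfl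
  refine ⟨s, ?_, hs.symm⟩
  have hne : NX u ≠ 0 := fun h => (hNX.eq_zero_iff u).1 h hu
  have h1 := hψ (Function.update u i₀ (t • u i₀))
  have h2 : (fun i => ψ (Function.update u i₀ (t • u i₀) i)) =
      Function.update (fun i => ψ (u i)) i₀ (s • ψ (u i₀)) := by
    funext i
    by_cases h : i = i₀
    · subst h
      simp [huv, hs]
    · simp [h]
  rw [h2, hNX.smul, hNY.smul (fun i => ψ (u i)) i₀ s, hψ] at h1
  exact mul_right_cancel₀ hne h1

/-- Mazur–Ulam theorem for `n`-normed spaces: every `n`-isometry between real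
`n`-normed spaces (`n ≥ 2`) is affine. -/
theorem nIsometry_affine
    {n : ℕ} (hn : 2 ≤ n)
    {X Y : Type*} [AddCommGroup X] [Module ℝ X] [AddCommGroup Y] [Module ℝ Y]
    (NX : (Fin n → X) → ℝ) (NY : (Fin n → Y) → ℝ)
    (hNX : IsNNorm n X NX) (hNY : IsNNorm n Y NY)
    (hdX : (n : Cardinal) ≤ Module.rank ℝ X) (hdY : (n : Cardinal) ≤ Module.rank ℝ Y)
    (φ : X → Y)
    (hφ : ∀ x : Fin (n + 1) → X,
      NY (fun i : Fin n => φ (x i.succ) - φ (x 0)) =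
      NX (fun i : Fin n => x i.succ - x 0)) :
    ∀ (x y : X) (t : ℝ), φ (t • x + (1 - t) • y) = t • φ x + (1 - t) • φ y := by
  intro x y t
  by_cases hxy : x = y
  · subst hxy
    simp [← add_smul]
  have key (p : X) (u : Fin n → X) : NY (fun i => φ (p + u i) - φ p) = NX u := by
    simpa using hφ (Fin.cons p fun i => p + u i)
  obtain ⟨hd, s, hs, hs'⟩ := hNX.exists_map_smul_eq hn hNY hdX
    (ψ := fun u => φ (y + u) - φ y) (key y) (sub_ne_zero.2 hxy) t
  obtain ⟨-, r, hr, hr'⟩ := hNX.exists_map_smul_eq hn hNY hdX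
    (ψ := fun u => φ (x + u) - φ x) (key x) (sub_ne_zero.2 (Ne.symm hxy)) (1 - t)
  have e1 : y + t • (x - y) = t • x + (1 - t) • y := by module
  have e2 : x + (1 - t) • (y - x) = t • x + (1 - t) • y := by module
  simp only [e1, add_sub_cancel] at hs' hd
  simp only [e2, add_sub_cancel] at hr'
  have hsr : s + r = 1 := by
    have h : (s + r - 1) • (φ x - φ y) = 0 := by
      have : (s + r - 1) • (φ x - φ y) =
          s • (φ x - φ y) - r • (φ y - φ x) - (φ x - φ y) := by module
      rw [this, ← hs', ← hr']
      abel
    linarith [(smul_eq_zero.1 h).resolve_right hd]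
  have hst : s = t := by
    rcases abs_eq_abs.1 hs with h | h
    · exact h
    · rcases abs_eq_abs.1 hr with h' | h' <;> linarith
  rw [hst] at hs'
  rw [sub_eq_iff_eq_add.1 hs']
  module
end

section
/- (Extension of the fundamental theorem of affine geometry.) Let X and Y be real vector spaces of dimension at least two, and let η : X → Y be an injective lineation whose range is not contained in any affine line of Y. Then η is affine: η(t·x + (1−t)·y) = t·η(x) + (1−t)·η(y) for all x, y ∈ X and t ∈ ℝ. -/
/-- Two real functions are related by a (nondegenerate) Möbius transformation. -/
def MoebiusRelated {ι : Type*} (φ ψ : ι → ℝ) : Prop :=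
  ∃ a b p q : ℝ, a * q - b * p ≠ 0 ∧ ∀ t, ψ t * (p * φ t + q) = a * φ t + b

theorem MoebiusRelated.symm {ι : Type*} {φ ψ : ι → ℝ} (h : MoebiusRelated φ ψ) :
    MoebiusRelated ψ φ := by
  obtain ⟨a, b, p, q, hd, h⟩ := h
  refine ⟨-q, b, p, -a, ?_, fun t => ?_⟩
  · intro h0
    apply hd
    linarith
  · linarith [h t]

theorem MoebiusRelated.trans {ι : Type*} {φ ψ χ : ι → ℝ} (h : MoebiusRelated φ ψ)
    (h' : MoebiusRelated ψ χ) : MoebiusRelated φ χ := by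
  obtain ⟨a, b, p, q, hd, h⟩ := h
  obtain ⟨a', b', p', q', hd', h'⟩ := h'
  refine ⟨a' * a + b' * p, a' * b + b' * q, p' * a + q' * p, p' * b + q' * q, ?_, fun t => ?_⟩
  · have := mul_ne_zero hd hd'
    intro h0
    apply this
    linarith
  · linear_combination (p * φ t + q) * h' t + (a' - χ t * p') * h t

theorem MoebiusRelated.comp {ι κ : Type*} {φ ψ : ι → ℝ} (h : MoebiusRelated φ ψ) (g : κ → ι) :
    MoebiusRelated (φ ∘ g) (ψ ∘ g) := by
  obtain ⟨a, b, p, q, hd, h⟩ := h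
  exact ⟨a, b, p, q, hd, fun t => h (g t)⟩

/-- A multiplicative injection of the reals for which the unit translation is a Möbius
transformation is the identity. -/
theorem eq_id_of_map_mul_of_moebiusRelated {θ : ℝ → ℝ} (hinj : Function.Injective θ)
    (h0 : θ 0 = 0) (h1 : θ 1 = 1) (hmul : ∀ s t, θ (s * t) = θ s * θ t)
    (hadd : MoebiusRelated θ fun t => θ (t + 1)) (t : ℝ) : θ t = t := by
  have hneg1 : θ (-1) = -1 := by
    have h : θ (-1) * θ (-1) = 1 := by rw [← hmul]; norm_num [h1]
    rcases mul_self_eq_one_iff.mp h with h | h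
    · exact absurd (hinj (h.trans h1.symm)) (by norm_num)
    · exact h
  obtain ⟨a, b, p, q, hd, h⟩ := hadd
  have e0 : q = b := by simpa [h0, h1] using h 0
  have e1 : a = b := by
    have := h (-1)
    simp only [neg_add_cancel, h0, hneg1] at this
    linarith
  subst e0 e1
  have ha : a ≠ 0 := by
    rintro rfl
    simp at hd
  have e2 : θ 2 * (p + a) = 2 * a := by
    have := h 1
    norm_num [h1] at this
    linarith
  have e3 : θ 2 * θ (1 / 2) = 1 := by rw [← hmul]; norm_num [h1]
  have e4 : θ (-(1 / 2)) = -θ (1 / 2) := by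
    rw [← neg_one_mul, hmul, hneg1, neg_one_mul]
  have e5 : θ (1 / 2) * (-(p * θ (1 / 2)) + a) = -(a * θ (1 / 2)) + a := by
    have := h (-(1 / 2))
    rw [e4] at this
    norm_num at this ⊢
    linarith
  have hp : p = 0 := by
    have hpa : p + a = 2 * a * θ (1 / 2) := by
      linear_combination θ (1 / 2) * e2 - (p + a) * e3
    set k := θ (1 / 2) with hk
    have hk1 : k ≠ 1 := by
      intro h
      exact absurd (hinj (hk.symm.trans (h.trans h1.symm))) (by norm_num)
    have hk2 : k ≠ -1 := by
      intro h
      exact absurd (hinj (hk.symm.trans (h.trans hneg1.symm))) (by norm_num)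
    have hp' : p = 2 * a * k - a := by linarith
    rw [hp'] at e5 ⊢
    have : a * ((k - 1) * ((k + 1) * (2 * k - 1))) = 0 := by
      linear_combination -e5
    have h2 : 2 * k - 1 = 0 := by
      simpa [ha, sub_ne_zero.mpr hk1, add_eq_zero_iff_eq_neg, hk2] using this
    linear_combination a * h2
  have hsucc : ∀ t, θ (t + 1) = θ t + 1 := by
    intro t
    have := h t
    rw [hp] at this
    apply mul_right_cancel₀ ha
    linarith
  let σ : ℝ →+* ℝ :=
    { toFun := θ
      map_one' := h1
      map_mul' := hmul
      map_zero' := h0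
      map_add' := by
        intro s t
        by_cases ht : t = 0
        · simp [ht, h0]
        · have : s + t = t * (s / t + 1) := by field_simp
          rw [this, hmul, hsucc, mul_add, ← hmul, mul_div_cancel₀ _ ht, mul_one] }
  exact DFunLike.congr_fun (Subsingleton.elim σ (RingHom.id ℝ)) t

/-- An injection of the reals that intertwines affine maps with Möbius transformations and fixes
`0` and `1` is the identity. -/
theorem eq_id_of_forall_moebiusRelated {φ : ℝ → ℝ} (hinj : Function.Injective φ)
    (h0 : φ 0 = 0) (h1 : φ 1 = 1)
    (h : ∀ l m : ℝ, l ≠ 0 → MoebiusRelated φ fun t => φ (l * t + m)) (t : ℝ) : φ t = t := by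
  have hne : ∀ t, t ≠ 0 → φ t ≠ 0 := fun t ht h => ht (hinj (h.trans h0.symm))
  have hdil : ∀ l : ℝ, l ≠ 0 → ∃ α β : ℝ, ∀ t, t ≠ 0 → (φ (l * t))⁻¹ = α + β * (φ t)⁻¹ := by
    intro l hl
    obtain ⟨a, b, p, q, hd, h⟩ := h l 0 hl
    have hb : b = 0 := by simpa [h0] using (h 0).symm
    subst hb
    have ha : a ≠ 0 := by
      rintro rfl
      simp at hd
    refine ⟨p / a, q / a, fun t ht => ?_⟩
    have := h t
    simp only [add_zero] at this
    have h2 := hne t ht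
    have h3 := hne (l * t) (mul_ne_zero hl ht)
    field_simp
    linarith
  obtain ⟨c, hc⟩ : ∃ c : ℝ, ∀ t, t ≠ 0 → (φ (-t))⁻¹ = 2 * c - (φ t)⁻¹ := by
    obtain ⟨α, β, h⟩ := hdil (-1) (by norm_num)
    simp only [neg_one_mul] at h
    have e1 := h 1 one_ne_zero
    have e2 := h (-1) (by norm_num)
    have e3 := h 2 two_ne_zero
    have e4 := h (-2) (by norm_num)
    rw [neg_neg] at e2 e4
    have n1 : (φ 2)⁻¹ - (φ 1)⁻¹ ≠ 0 := by
      rw [sub_ne_zero]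
      intro h
      exact absurd (hinj (inv_injective h)) (by norm_num)
    have hb : (β - 1) * (β + 1) = 0 := by
      apply mul_right_cancel₀ n1
      linear_combination e2 + β * e1 - e4 - β * e3
    rcases mul_eq_zero.mp hb with hb | hb
    · have hb : β = 1 := by linarith
      subst hb
      have hα : α = 0 := by linarith
      subst hα
      have : φ (-1) = φ 1 := inv_injective (by linarith)
      exact absurd (hinj this) (by norm_num)
    · refine ⟨α / 2, fun t ht => ?_⟩
      rw [h t ht]
      linear_combination (φ t)⁻¹ * hb
  set χ : ℝ → ℝ := fun t => (φ t)⁻¹ - c with hχ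
  have hχneg : ∀ t, t ≠ 0 → χ (-t) = -χ t := by
    intro t ht
    simp only [hχ, hc t ht]
    ring
  have hχinj : Function.Injective χ := by
    intro s t hst
    exact hinj (inv_injective (sub_left_injective hst))
  have hχne : ∀ t, t ≠ 0 → χ t ≠ 0 := by
    intro t ht h
    have := hχinj ((hχneg t ht).trans (by rw [h, neg_zero]) : χ (-t) = χ t)
    exact ht (by linarith)
  have hχmul : ∀ s t, s ≠ 0 → t ≠ 0 → χ (s * t) * χ 1 = χ s * χ t := by
    intro s t hs ht
    obtain ⟨α, β, h⟩ := hdil s hs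
    have h' : ∀ t, t ≠ 0 → χ (s * t) = (α + β * c - c) + β * χ t := by
      intro t ht
      simp only [hχ, h t ht]
      ring
    have hα : α + β * c - c = 0 := by
      have e1 := h' t ht
      have e2 := h' (-t) (neg_ne_zero.mpr ht)
      rw [mul_neg, hχneg t ht, hχneg _ (mul_ne_zero hs ht)] at e2
      linarith
    have e1 := h' t ht
    have e2 := h' 1 one_ne_zero
    rw [mul_one] at e2
    rw [e1, e2, hα]
    ring
  set θ : ℝ → ℝ := fun t => if t = 0 then 0 else χ 1 / χ t with hθ
  have hχ1 := hχne 1 one_ne_zero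
  have hθ0 : θ 0 = 0 := by simp [hθ]
  have hθ1 : θ 1 = 1 := by simp [hθ, hχ1]
  have hθne : ∀ t, t ≠ 0 → θ t = χ 1 / χ t := fun t ht => by simp [hθ, ht]
  have hφθ : ∀ t, φ t * (χ 1 + c * θ t) = θ t := by
    intro t
    by_cases ht : t = 0
    · simp [ht, hθ0, h0]
    · rw [hθne t ht]
      have h2 := hne t ht
      have h3 := hχne t ht
      have h4 : φ t * (χ t + c) = 1 := by simp [hχ, h2]
      field_simp
      linear_combination h4
  have hθinj : Function.Injective θ := by
    intro s t hst
    by_cases hs : s = 0 <;> by_cases ht : t = 0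
    · rw [hs, ht]
    · rw [hs, hθ0, hθne t ht] at hst
      exact absurd hst.symm (div_ne_zero hχ1 (hχne t ht))
    · rw [ht, hθ0, hθne s hs] at hst
      exact absurd hst (div_ne_zero hχ1 (hχne s hs))
    · rw [hθne t ht, hθne s hs] at hst
      have h3 := hχne t ht
      have h4 := hχne s hs
      apply hχinj
      field_simp at hst
      linarith
  have hθmul : ∀ s t, θ (s * t) = θ s * θ t := by
    intro s t
    by_cases hs : s = 0
    · simp [hs, hθ0]
    by_cases ht : t = 0
    · simp [ht, hθ0]
    rw [hθne t ht, hθne s hs, hθne _ (mul_ne_zero hs ht)]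
    have h3 := hχne t ht
    have h4 := hχne s hs
    have h5 := hχne _ (mul_ne_zero hs ht)
    have := hχmul s t hs ht
    field_simp
    linarith
  have hrel : MoebiusRelated φ θ :=
    MoebiusRelated.symm ⟨1, 0, c, χ 1, by simpa using hχ1, fun t => by linarith [hφθ t]⟩
  have hadd : MoebiusRelated θ fun t => θ (t + 1) := by
    have := h 1 1 one_ne_zero
    simp only [one_mul] at this
    exact hrel.symm.trans (this.trans (hrel.comp fun t => t + 1))
  have hid := eq_id_of_map_mul_of_moebiusRelated hθinj hθ0 hθ1 hθmul hadd
  have hc0 : c = 0 := by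
    by_contra hc0
    have := hφθ (-χ 1 / c)
    rw [hid, mul_div_cancel₀ _ hc0, add_neg_cancel, mul_zero] at this
    exact div_ne_zero (neg_ne_zero.mpr hχ1) hc0 this.symm
  have e1 := hφθ 1
  have e2 := hφθ t
  rw [hid, hc0] at e1 e2
  rw [h1] at e1
  have : χ 1 = 1 := by linarith
  rw [this] at e2
  linarith

/-- If the preimage of an affine subspace under a map sending lines into lines contains three
points of the plane, not on a line parallel to the first axis, it is everything. -/
theorem mem_of_mem_triangle {Y : Type*} [AddCommGroup Y] [Module ℝ Y] {f : ℝ × ℝ → Y}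
    (hK : ∀ p q : ℝ × ℝ, ∀ t : ℝ, ∃ s : ℝ, f (p + t • (q - p)) = f p + s • (f q - f p))
    (S : AffineSubspace ℝ Y) {h₀ h c : ℝ} (hh : h ≠ h₀) (hp : f (0, h₀) ∈ S)
    (hq : f (1, h₀) ∈ S) (hr : f (c, h) ∈ S) (z : ℝ × ℝ) : f z ∈ S := by
  have hline : ∀ p q : ℝ × ℝ, ∀ t : ℝ, f p ∈ S → f q ∈ S → f (p + t • (q - p)) ∈ S := by
    intro p q t hp hq
    obtain ⟨s, hs⟩ := hK p q t
    rw [hs, add_comm]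
    exact S.smul_vsub_vadd_mem s hq hp hp
  have hbase : ∀ t, f (t, h₀) ∈ S := by
    intro t
    have := hline _ _ t hp hq
    simpa using this
  have hne : h - h₀ ≠ 0 := sub_ne_zero.mpr hh
  have hoff : ∀ a b : ℝ, b ≠ h → f (a, b) ∈ S := by
    intro a b hb
    have hb' : h - b ≠ 0 := sub_ne_zero.mpr hb.symm
    have := hline (c, h) (c + (h - h₀) / (h - b) * (a - c), h₀) ((h - b) / (h - h₀)) hr
      (hbase _)
    convert this using 2
    ext
    · simp
      field_simp
      ring
    · simp
      field_simp
      ring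
  obtain ⟨a, b⟩ := z
  by_cases hb : b = h
  · subst hb
    have := hline (a, b - 1) (a, b + 1) (1 / 2) (hoff _ _ (by linarith))
      (hoff _ _ (by linarith))
    convert this using 2
    ext
    · simp
    · simp
      ring
  · exact hoff a b hb

/-- A family of lines through a common point cuts two lines of the plane in parameters that are
related by a Möbius transformation. -/
theorem moebiusRelated_of_perspective {ι Y : Type*} [AddCommGroup Y] [Module ℝ Y]
    {e d w v : Y} {φ ψ σ : ι → ℝ} (hed : LinearIndependent ℝ ![e, d])
    (hwv : LinearIndependent ℝ ![w, v]) (i j : ι) (hij : ψ i ≠ ψ j)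
    (h : ∀ t, w + ψ t • v = σ t • (e + φ t • d)) : MoebiusRelated φ ψ := by
  rw [LinearIndependent.pair_iff] at hed hwv
  have hne : ψ i - ψ j ≠ 0 := sub_ne_zero.mpr hij
  obtain ⟨v₁, v₂, hv⟩ : ∃ v₁ v₂ : ℝ, v = v₁ • e + v₂ • d := by
    refine ⟨(σ i - σ j) / (ψ i - ψ j), (σ i * φ i - σ j * φ j) / (ψ i - ψ j), ?_⟩
    have : (ψ i - ψ j) • v = (σ i - σ j) • e + (σ i * φ i - σ j * φ j) • d := by
      linear_combination (norm := module) h i - h j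
    rw [← inv_smul_smul₀ hne v, this]
    module
  obtain ⟨w₁, w₂, hw⟩ : ∃ w₁ w₂ : ℝ, w = w₁ • e + w₂ • d := by
    refine ⟨σ i - ψ i * v₁, σ i * φ i - ψ i * v₂, ?_⟩
    have := h i
    rw [hv] at this
    linear_combination (norm := module) this
  refine ⟨-w₁, w₂, v₁, -v₂, ?_, fun t => ?_⟩
  · intro hdet
    have key : v₁ • w + (-w₁) • v = (0 : Y) ∧ v₂ • w + (-w₂) • v = (0 : Y) := by
      rw [hv, hw]
      constructor
      · have : v₁ * w₂ - w₁ * v₂ = 0 := by linarith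
        linear_combination (norm := module) this • d
      · have : v₂ * w₁ - w₂ * v₁ = 0 := by linarith
        linear_combination (norm := module) this • e
    have h1 := (hwv _ _ key.1).1
    have h2 := (hwv _ _ key.2).1
    rw [h1, h2] at hv
    have := (hwv 0 1 (by simp [hv])).2
    exact one_ne_zero this
  · have := h t
    rw [hv, hw] at this
    obtain ⟨e1, e2⟩ := hed (w₁ + ψ t * v₁ - σ t) (w₂ + ψ t * v₂ - σ t * φ t) (by
      linear_combination (norm := module) this)
    linear_combination φ t * e1 - e2

/-- The planar case, along the first axis. -/
theorem map_axis_of_injective_lineation {Y : Type*} [AddCommGroup Y] [Module ℝ Y]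
    {f : ℝ × ℝ → Y} (hinj : Function.Injective f)
    (hK : ∀ p q : ℝ × ℝ, ∀ t : ℝ, ∃ s : ℝ, f (p + t • (q - p)) = f p + s • (f q - f p))
    (hrange : ¬ Collinear ℝ (Set.range f)) (t : ℝ) :
    f (t, 0) = f (0, 0) + t • (f (1, 0) - f (0, 0)) := by
  have hrow : ∀ b t : ℝ, ∃ s : ℝ, f (t, b) = f (0, b) + s • (f (1, b) - f (0, b)) := by
    intro b t
    obtain ⟨s, hs⟩ := hK (0, b) (1, b) t
    refine ⟨s, ?_⟩
    rw [← hs]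
    simp
  have hoff : ∀ b c h : ℝ, h ≠ b →
      LinearIndependent ℝ ![f (0, b) - f (c, h), f (1, b) - f (0, b)] := by
    intro b c h hb
    have hd : f (1, b) - f (0, b) ≠ 0 := by
      rw [sub_ne_zero]
      intro h
      simpa using hinj h
    rw [LinearIndependent.pair_symm_iff, LinearIndependent.pair_iff' hd]
    intro s hs
    apply hrange
    rw [collinear_iff_exists_forall_eq_smul_vadd]
    refine ⟨f (0, b), f (1, b) - f (0, b), ?_⟩
    rintro _ ⟨z, rfl⟩
    have := mem_of_mem_triangle hK (line[ℝ, f (0, b), f (1, b)]) hb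
      (left_mem_affineSpan_pair ℝ _ _) (right_mem_affineSpan_pair ℝ _ _)
      (c := c) (by
        rw [mem_affineSpan_pair_iff_exists_lineMap_eq]
        refine ⟨-s, ?_⟩
        rw [AffineMap.lineMap_apply, vsub_eq_sub, vadd_eq_add, neg_smul, hs]
        abel) z
    rw [mem_affineSpan_pair_iff_exists_lineMap_eq] at this
    obtain ⟨r, hr⟩ := this
    exact ⟨r, by rw [← hr, AffineMap.lineMap_apply, vsub_eq_sub]⟩
  choose φ hφ using hrow 0
  choose ψ hψ using hrow 1
  have hd : f (1, 0) - f (0, 0) ≠ 0 := by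
    rw [sub_ne_zero]
    intro h
    simpa using hinj h
  have hφ0 : φ 0 = 0 := by
    have := hφ 0
    simpa [hd] using this
  have hφ1 : φ 1 = 1 := by
    have := hφ 1
    have h2 : (φ 1 - 1) • (f (1, 0) - f (0, 0)) = 0 := by
      linear_combination (norm := module) -this
    simpa [hd, sub_eq_zero] using h2
  have hφinj : Function.Injective φ := by
    intro s t hst
    have : f (s, 0) = f (t, 0) := by rw [hφ s, hφ t, hst]
    simpa using hinj this
  have hψinj : Function.Injective ψ := by
    intro s t hst
    have : f (s, 1) = f (t, 1) := by rw [hψ s, hψ t, hst]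
    simpa using hinj this
  have hpersp : ∀ l m : ℝ, l ≠ 0 → l ≠ 1 → MoebiusRelated φ fun t => ψ (l * t + m) := by
    intro l m hl hl1
    have hl' : 1 - l ≠ 0 := sub_ne_zero.mpr hl1.symm
    have hh0 : 1 / (1 - l) ≠ 0 := one_div_ne_zero hl'
    have hh1 : 1 / (1 - l) ≠ 1 := by
      intro h
      rw [div_eq_one_iff_eq hl'] at h
      exact hl (by linarith)
    have hcol : ∀ t, ∃ s : ℝ, f (l * t + m, 1) =
        f (m / (1 - l), 1 / (1 - l)) + s • (f (t, 0) - f (m / (1 - l), 1 / (1 - l))) := by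
      intro t
      obtain ⟨s, hs⟩ := hK (m / (1 - l), 1 / (1 - l)) (t, 0) l
      refine ⟨s, ?_⟩
      rw [← hs]
      congr 1
      ext
      · simp
        field_simp
        ring
      · simp
        field_simp
        ring
    choose σ hσ using hcol
    refine moebiusRelated_of_perspective (σ := σ) (hoff 0 (m / (1 - l)) _ hh0)
      (hoff 1 (m / (1 - l)) _ hh1) 0 1 ?_ ?_
    · intro h
      have := hψinj h
      exact hl (by linarith)
    · intro t
      have := hσ t
      rw [hφ t, hψ (l * t + m)] at this
      linear_combination (norm := module) this
  have hmoeb : ∀ l m : ℝ, l ≠ 0 → MoebiusRelated φ fun t => φ (l * t + m) := by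
    intro l m hl
    obtain ⟨β, hβ⟩ := (Set.toFinite ({0, 1, l⁻¹} : Set ℝ)).exists_notMem
    simp only [Set.mem_insert_iff, Set.mem_singleton_iff, not_or] at hβ
    obtain ⟨hβ0, hβ1, hβl⟩ := hβ
    have hA := (hpersp β 0 hβ0 hβ1).comp fun t => l * t + m
    have hB := hpersp (β * l) (β * m) (mul_ne_zero hβ0 hl)
      (fun h => hβl (eq_inv_of_mul_eq_one_left h))
    refine hB.trans ?_
    have hcomp : (fun t => ψ (β * l * t + β * m)) =
        (fun t => ψ (β * t + 0)) ∘ fun t => l * t + m := by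
      funext t
      simp only [Function.comp_apply]
      congr 1
      ring
    rw [hcomp]
    exact hA.symm
  rw [hφ t, eq_id_of_forall_moebiusRelated hφinj hφ0 hφ1 hmoeb t]

/-- Fundamental theorem of affine geometry (extension): an injective lineation between
real vector spaces of dimension at least two, whose range is not contained in any
affine line, is affine. -/
theorem injective_lineation_affine
    {X Y : Type*} [AddCommGroup X] [Module ℝ X] [AddCommGroup Y] [Module ℝ Y]
    (hdX : (2 : Cardinal) ≤ Module.rank ℝ X) (hdY : (2 : Cardinal) ≤ Module.rank ℝ Y)
    (η : X → Y) (hinj : Function.Injective η)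
    (hlin : ∀ p q r : X, Collinear ℝ ({p, q, r} : Set X) →
      Collinear ℝ ({η p, η q, η r} : Set Y))
    (hrange : ¬ Collinear ℝ (Set.range η)) :
    ∀ (x y : X) (t : ℝ), η (t • x + (1 - t) • y) = t • η x + (1 - t) • η y := by
  intro x y t
  have hK : ∀ p q : X, ∀ t : ℝ, ∃ s : ℝ, η (p + t • (q - p)) = η p + s • (η q - η p) := by
    intro p q t
    by_cases hpq : p = q
    · exact ⟨0, by simp [hpq]⟩
    have h1 : Collinear ℝ ({p, q, p + t • (q - p)} : Set X) := by
      rw [collinear_iff_of_mem (p₀ := p) (by simp)]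
      refine ⟨q - p, ?_⟩
      simp only [Set.mem_insert_iff, Set.mem_singleton_iff, vadd_eq_add]
      rintro _ (rfl | rfl | rfl)
      · exact ⟨0, by simp⟩
      · exact ⟨1, by simp⟩
      · exact ⟨t, by abel⟩
    have h2 := (hlin _ _ _ h1).mem_affineSpan_of_mem_of_ne (p₁ := η p) (p₂ := η q)
      (p₃ := η (p + t • (q - p))) (by simp) (by simp) (by simp) (hinj.ne hpq)
    rw [mem_affineSpan_pair_iff_exists_lineMap_eq] at h2
    obtain ⟨s, hs⟩ := h2
    exact ⟨s, by rw [← hs, AffineMap.lineMap_apply, vsub_eq_sub, vadd_eq_add, add_comm]⟩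
  by_cases hxy : x = y
  · subst hxy
    rw [← add_smul, ← add_smul]
    simp
  obtain ⟨z, hz⟩ : ∃ z, ∀ s : ℝ, η z ≠ η y + s • (η x - η y) := by
    by_contra! hcon
    apply hrange
    rw [collinear_iff_exists_forall_eq_smul_vadd]
    refine ⟨η y, η x - η y, ?_⟩
    rintro _ ⟨z, rfl⟩
    obtain ⟨s, hs⟩ := hcon z
    exact ⟨s, by rw [hs, vadd_eq_add, add_comm]⟩
  have hind : LinearIndependent ℝ ![x - y, z - y] := by
    rw [LinearIndependent.pair_iff' (sub_ne_zero.mpr hxy)]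
    intro a ha
    obtain ⟨s, hs⟩ := hK y x a
    rw [ha, add_sub_cancel] at hs
    exact hz s hs
  rw [LinearIndependent.pair_iff] at hind
  let f : ℝ × ℝ → Y := fun p => η (y + p.1 • (x - y) + p.2 • (z - y))
  have hf := map_axis_of_injective_lineation (f := f) ?_ ?_ ?_ t
  · have e1 : f (t, 0) = η (t • x + (1 - t) • y) := by
      simp only [f]
      congr 1
      module
    have e2 : f (0, 0) = η y := by simp [f]
    have e3 : f (1, 0) = η x := by simp [f]
    rw [e1, e2, e3] at hf
    rw [hf]
    module
  · intro p q hpq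
    have := hinj hpq
    obtain ⟨h1, h2⟩ := hind (p.1 - q.1) (p.2 - q.2) (by
      linear_combination (norm := module) this)
    exact Prod.ext (sub_eq_zero.mp h1) (sub_eq_zero.mp h2)
  · intro p q s
    obtain ⟨r, hr⟩ := hK (y + p.1 • (x - y) + p.2 • (z - y)) (y + q.1 • (x - y) + q.2 • (z - y)) s
    refine ⟨r, ?_⟩
    simp only [f]
    rw [← hr]
    congr 1
    simp only [Prod.fst_add, Prod.snd_add, Prod.smul_fst, Prod.smul_snd, Prod.fst_sub,
      Prod.snd_sub, smul_eq_mul]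
    module
  · intro hcol
    have hy : η y ∈ Set.range f := ⟨(0, 0), by simp [f]⟩
    have hx : η x ∈ Set.range f := ⟨(1, 0), by simp [f]⟩
    have hz' : η z ∈ Set.range f := ⟨(0, 1), by simp [f]⟩
    have := hcol.mem_affineSpan_of_mem_of_ne hy hx hz' (hinj.ne (Ne.symm hxy))
    rw [mem_affineSpan_pair_iff_exists_lineMap_eq] at this
    obtain ⟨s, hs⟩ := this
    exact hz s (by rw [← hs, AffineMap.lineMap_apply, vsub_eq_sub, vadd_eq_add, add_comm])
end

section
/- Let n ≥ 2, let X and Y be real n-normed spaces with n-norms N_X and N_Y, and let φ : X → Y satisfy N_Y(φ(x₁),…,φ(xₙ)) = N_X(x₁,…,xₙ) for all x₁,…,xₙ ∈ X. Then for every 2 ≤ k ≤ n and all x₁,…,x_k ∈ X, the vectors x₁,…,x_k are linearly independent if and only if φ(x₁),…,φ(x_k) are linearly independent. -/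
/-- Steinitz exchange along a map: if `f ∘ x` is a linearly independent family of `k ≤ n` vectors
and `f ∘ e` is a linearly independent family of `n` vectors, then `x` extends to an `n`-tuple `w`
such that `f ∘ w` is linearly independent. -/
theorem exists_linearIndependent_comp_extension {K ι V : Type*} [DivisionRing K] [AddCommGroup V]
    [Module K V] (f : ι → V) {k n : ℕ} (hkn : k ≤ n) (x : Fin k → ι)
    (hx : LinearIndependent K (f ∘ x)) (e : Fin n → ι) (he : LinearIndependent K (f ∘ e)) :
    ∃ w : Fin n → ι, w ∘ Fin.castLE hkn = x ∧ LinearIndependent K (f ∘ w) := by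
  suffices H : ∀ m, ∀ hkm : k ≤ m, m ≤ n →
      ∃ w : Fin m → ι, w ∘ Fin.castLE hkm = x ∧ LinearIndependent K (f ∘ w) from
    H n hkn le_rfl
  intro m hkm
  induction m, hkm using Nat.le_induction with
  | base => exact fun _ => ⟨x, by ext; simp, hx⟩
  | succ m hkm ih =>
    intro hmn
    obtain ⟨w, hwx, hw⟩ := ih (by lia)
    obtain ⟨j, hj⟩ : ∃ j, f (e j) ∉ Submodule.span K (Set.range (f ∘ w)) := by
      by_contra! h
      have hle : Submodule.span K (Set.range (f ∘ e)) ≤ Submodule.span K (Set.range (f ∘ w)) :=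
        Submodule.span_le.2 (Set.range_subset_iff.2 h)
      have : Module.Finite K (Submodule.span K (Set.range (f ∘ w))) :=
        FiniteDimensional.span_of_finite K (Set.finite_range _)
      have hrank := Submodule.finrank_mono hle
      rw [finrank_span_eq_card he, finrank_span_eq_card hw, Fintype.card_fin,
        Fintype.card_fin] at hrank
      lia
    refine ⟨Fin.snoc w (e j), ?_, ?_⟩
    · funext i
      rw [← hwx]
      exact Fin.snoc_castSucc (α := fun _ => ι) (e j) w (Fin.castLE hkm i)
    · rw [Fin.comp_snoc, linearIndependent_finSnoc]
      exact ⟨hw, hj⟩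

/-- An `n`-norm preserver preserves linear independence of `n`-tuples in both directions. -/
theorem IsNNorm.linearIndependent_iff_of_preserves {n : ℕ} {X Y : Type*} [AddCommGroup X]
    [Module ℝ X] [AddCommGroup Y] [Module ℝ Y] {NX : (Fin n → X) → ℝ} {NY : (Fin n → Y) → ℝ}
    (hNX : IsNNorm n X NX) (hNY : IsNNorm n Y NY) {φ : X → Y}
    (hφ : ∀ x : Fin n → X, NY (fun i => φ (x i)) = NX x) (x : Fin n → X) :
    LinearIndependent ℝ x ↔ LinearIndependent ℝ (φ ∘ x) := by
  rw [← not_iff_not, ← hNX.eq_zero_iff, ← hNY.eq_zero_iff, ← hφ]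
  rfl

/-- An `n`-norm preserver between real `n`-normed spaces (`n ≥ 2`) preserves linear
independence of `k` vectors (`2 ≤ k ≤ n`) in both directions. -/
theorem nNormPreserver_linearIndependent_iff
    {n : ℕ} (hn : 2 ≤ n)
    {X Y : Type*} [AddCommGroup X] [Module ℝ X] [AddCommGroup Y] [Module ℝ Y]
    (NX : (Fin n → X) → ℝ) (NY : (Fin n → Y) → ℝ)
    (hNX : IsNNorm n X NX) (hNY : IsNNorm n Y NY)
    (hdX : (n : Cardinal) ≤ Module.rank ℝ X) (hdY : (n : Cardinal) ≤ Module.rank ℝ Y)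
    (φ : X → Y)
    (hφ : ∀ x : Fin n → X, NY (fun i => φ (x i)) = NX x) :
    ∀ k : ℕ, 2 ≤ k → k ≤ n → ∀ x : Fin k → X,
      (LinearIndependent ℝ x ↔ LinearIndependent ℝ (fun i => φ (x i))) := by
  intro k _ hkn x
  have key := hNX.linearIndependent_iff_of_preserves hNY hφ
  obtain ⟨e, he⟩ := Module.le_rank_iff.1 hdX
  have hinj := Fin.castLE_injective hkn
  constructor
  · intro hx
    obtain ⟨w, rfl, hw⟩ := exists_linearIndependent_comp_extension id hkn x hx e he
    exact ((key w).1 hw).comp _ hinj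
  · intro hx
    obtain ⟨w, rfl, hw⟩ := exists_linearIndependent_comp_extension φ hkn x hx e ((key e).1 he)
    exact ((key w).2 hw).comp _ hinj
end

section
/- Let n ≥ 3, let X be a real vector space with dim X ≥ n, let N be an n-norm on X, and let x₁,…,xₙ ∈ X be linearly independent. Let L = span{x₁, x₂}. Then the function N₂ : L × L → ℝ defined by N₂(z₁, z₂) := N(z₁, z₂, x₃, …, xₙ) is a 2-norm on the two-dimensional space L; that is: N₂ ≥ 0; N₂(z₁, z₂) = 0 if and only if z₁, z₂ are linearly dependent; N₂(z₁, z₂) = N₂(z₂, z₁); N₂(α·z₁, z₂) = |α|·N₂(z₁, z₂) for all α ∈ ℝ; and N₂(z₁ + w, z₂) ≤ N₂(z₁, z₂) + N₂(w, z₂) for all z₁, z₂, w ∈ L. -/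
/-- A finite family is linearly independent if its span contains a linearly independent family
with the same index type. -/
theorem LinearIndependent.of_span_range_le {K V ι : Type*} [DivisionRing K] [AddCommGroup V]
    [Module K V] [Fintype ι] {v w : ι → V} (hv : LinearIndependent K v)
    (h : ∀ i, v i ∈ Submodule.span K (Set.range w)) : LinearIndependent K w := by
  rw [linearIndependent_iff_card_le_finrank_span] at hv ⊢
  have := Module.Finite.span_of_finite K (Set.finite_range w)
  refine hv.trans (Submodule.finrank_mono (Submodule.span_le.2 ?_))
  rintro _ ⟨i, rfl⟩
  exact h i

/-- Fixing linearly independent `x₁, …, xₙ` and letting `L = span {x₁, x₂}`, the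
function `N₂ (z₁, z₂) = N (z₁, z₂, x₃, …, xₙ)` is a 2-norm on the two-dimensional
subspace `L`. -/
theorem restriction_is_twoNorm
    {n : ℕ} (hn : 3 ≤ n)
    {X : Type*} [AddCommGroup X] [Module ℝ X]
    (hdX : (n : Cardinal) ≤ Module.rank ℝ X)
    (N : (Fin n → X) → ℝ) (hN : IsNNorm n X N)
    (x : Fin n → X) (hx : LinearIndependent ℝ x)
    (L : Submodule ℝ X)
    (hL : L = Submodule.span ℝ {x ⟨0, by omega⟩, x ⟨1, by omega⟩})
    (N₂ : L → L → ℝ)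
    (hN₂ : ∀ z₁ z₂ : L, N₂ z₁ z₂ =
      N (fun i => if i = (⟨0, by omega⟩ : Fin n) then (z₁ : X)
          else if i = (⟨1, by omega⟩ : Fin n) then (z₂ : X) else x i)) :
    Module.finrank ℝ L = 2 ∧
    (∀ z₁ z₂ : L, 0 ≤ N₂ z₁ z₂) ∧
    (∀ z₁ z₂ : L, N₂ z₁ z₂ = 0 ↔ ¬ LinearIndependent ℝ ![z₁, z₂]) ∧
    (∀ z₁ z₂ : L, N₂ z₁ z₂ = N₂ z₂ z₁) ∧
    (∀ (z₁ z₂ : L) (α : ℝ), N₂ (α • z₁) z₂ = |α| * N₂ z₁ z₂) ∧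
    (∀ z₁ z₂ w : L, N₂ (z₁ + w) z₂ ≤ N₂ z₁ z₂ + N₂ w z₂) := by
  set a : Fin n := ⟨0, by omega⟩ with ha
  set b : Fin n := ⟨1, by omega⟩ with hb
  have hab : a ≠ b := by simp [ha, hb]
  have hinj : Function.Injective ![a, b] := by
    intro i j h
    fin_cases i <;> fin_cases j <;> simp_all
  have hrange (u v : X) : Set.range ![u, v] = {u, v} := by simp [Set.pair_comm]
  have hxab : LinearIndependent ℝ ![x a, x b] := by
    convert hx.comp _ hinj using 1
    ext i
    fin_cases i <;> rfl
  have hfin : Module.finrank ℝ L = 2 := by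
    rw [hL, ← hrange]
    simpa using finrank_span_eq_card hxab
  have : FiniteDimensional ℝ L := Module.finite_of_finrank_pos (by omega)
  let F (z₁ z₂ : X) : Fin n → X := fun i => if i = a then z₁ else if i = b then z₂ else x i
  have hFa (z₁ z₂ : X) : F z₁ z₂ a = z₁ := by simp [F]
  have hFb (z₁ z₂ : X) : F z₁ z₂ b = z₂ := by simp [F, hab.symm]
  have hF (z₁ z₂ w : X) : F w z₂ = Function.update (F z₁ z₂) a w := by
    ext i
    by_cases hi : i = a <;> simp [F, hi]
  replace hN₂ (z₁ z₂ : L) : N₂ z₁ z₂ = N (F z₁ z₂) := hN₂ z₁ z₂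
  have hcoe (z₁ z₂ : L) : ![(z₁ : X), (z₂ : X)] = L.subtype ∘ ![z₁, z₂] := by
    ext i
    fin_cases i <;> rfl
  have hind (z₁ z₂ : L) :
      LinearIndependent ℝ (F z₁ z₂) ↔ LinearIndependent ℝ ![z₁, z₂] := by
    refine ⟨fun h => .of_comp L.subtype ?_, fun h => ?_⟩
    · convert h.comp _ hinj using 1
      ext i
      fin_cases i <;> simp [hFa, hFb]
    · have h' : LinearIndependent ℝ ![(z₁ : X), (z₂ : X)] := by
        rw [hcoe]
        exact h.map' L.subtype L.ker_subtype
      have hspan : Submodule.span ℝ {(z₁ : X), (z₂ : X)} = L := by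
        refine Submodule.eq_of_le_of_finrank_eq (Submodule.span_le.2 ?_) ?_
        · rintro _ (rfl | rfl) <;> exact Subtype.coe_prop _
        · rw [hfin, ← hrange]
          simpa using finrank_span_eq_card h'
      have hle : L ≤ Submodule.span ℝ (Set.range (F z₁ z₂)) := by
        refine hspan.ge.trans (Submodule.span_mono ?_)
        rintro _ (rfl | rfl)
        exacts [⟨a, hFa _ _⟩, ⟨b, hFb _ _⟩]
      refine hx.of_span_range_le fun i => ?_
      by_cases hia : i = a
      · exact hle (hL ▸ Submodule.subset_span (by simp [hia]))
      by_cases hib : i = b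
      · exact hle (hL ▸ Submodule.subset_span (by simp [hib]))
      · exact Submodule.subset_span ⟨i, by simp [F, hia, hib]⟩
  refine ⟨hfin, fun z₁ z₂ => ?_, fun z₁ z₂ => ?_, fun z₁ z₂ => ?_, fun z₁ z₂ α => ?_,
    fun z₁ z₂ w => ?_⟩
  · rw [hN₂]
    exact hN.nonneg _
  · rw [hN₂, hN.eq_zero_iff, hind]
  · rw [hN₂, hN₂, ← hN.perm _ (Equiv.swap a b)]
    congr 1
    ext i
    by_cases hia : i = a
    · simp [hia, hFa, hFb]
    by_cases hib : i = b
    · simp [hib, hFa, hFb]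
    · simp [Equiv.swap_apply_of_ne_of_ne hia hib, F, hia, hib]
  · have h := hN.smul (F z₁ z₂) a α
    rw [hFa, ← hF] at h
    simpa [hN₂] using h
  · have h := hN.add_le (F z₁ z₂) a w
    rw [hFa, ← hF, ← hF] at h
    simpa [hN₂] using h
end
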